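/- arXiv:1803.09527 — 3 statements merged into one kernel-verified Lean document; each statement's English description precedes it below -/
import Mathlib

section
/- The pushforward of the backward annealing path measure under the order-reversal map equals the forward path measure weighted by the telescoping unnormalised density ratios: R_*Q' = Q . withDensity( u ↦ (C₀/C_{T+1}) ∏_{t=0}^{T} f_{t+1}(u_t)/f_t(u_t) ) (the density being well-defined Q-almost everywhere by the equal-support assumption). In particular R_*Q' is absolutely continuous with respect to Q with Radon–Nikodym derivative u ↦ (C₀/C_{T+1}) ∏_{t=0}^{T} f_{t+1}(u_t)/f_t(u_t). -/
open MeasureTheory ProbabilityTheory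
open scoped ENNReal

/-- The law on `Y^{n+1}` of an inhomogeneous Markov chain with initial distribution `μ0`
and transition kernels `κ 1, κ 2, …, κ n` (applied in this order). -/
noncomputable def chainLaw {E : Type*} [MeasurableSpace E] (μ0 : Measure E)
    (κ : ℕ → E → Measure E) : (n : ℕ) → Measure (Fin (n + 1) → E)
  | 0 => μ0.map (fun x _ => x)
  | n + 1 => (chainLaw μ0 κ n).bind
      (fun p => (κ (n + 1) (p (Fin.last n))).map (fun x => Fin.snoc p x))

/-- The kernel appending to a path `p` a point drawn from `κ (p last)`. -/
noncomputable def snocKernel {E : Type*} [MeasurableSpace E] (κ : Kernel E E) (n : ℕ) :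
    Kernel (Fin (n + 1) → E) (Fin (n + 2) → E) :=
  (Kernel.id ×ₖ κ.comap (fun p : Fin (n + 1) → E => p (Fin.last n)) (measurable_pi_apply _)).map
    (fun z => Fin.snoc z.1 z.2)

/-- The law of the path of length `n + 1` of an inhomogeneous Markov chain, as a kernel in the
starting point. -/
noncomputable def pathKernel {E : Type*} [MeasurableSpace E] (κ : ℕ → Kernel E E) :
    (n : ℕ) → Kernel E (Fin (n + 1) → E)
  | 0 => Kernel.deterministic (fun x _ => x) (by fun_prop)
  | n + 1 => snocKernel (κ (n + 1)) n ∘ₖ pathKernel κ n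

section PathKernel

variable {E : Type*} [MeasurableSpace E]

lemma measurable_snoc (n : ℕ) :
    Measurable (fun z : (Fin (n + 1) → E) × E => (Fin.snoc z.1 z.2 : Fin (n + 2) → E)) := by
  refine measurable_pi_lambda _ fun i => ?_
  induction i using Fin.lastCases with
  | last => simpa using measurable_snd
  | cast i => simpa [Function.comp_def] using (measurable_pi_apply i).comp measurable_fst

lemma measurable_cons (n : ℕ) :
    Measurable (fun z : E × (Fin (n + 1) → E) => (Fin.cons z.1 z.2 : Fin (n + 2) → E)) := by
  refine measurable_pi_lambda _ fun i => ?_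
  induction i using Fin.cases with
  | zero => simpa using measurable_fst
  | succ i => simpa [Function.comp_def] using (measurable_pi_apply i).comp measurable_snd

lemma measurable_rev (n : ℕ) :
    Measurable (fun (u : Fin (n + 1) → E) (i : Fin (n + 1)) => u i.rev) := by
  fun_prop

instance (κ : Kernel E E) [IsMarkovKernel κ] (n : ℕ) : IsMarkovKernel (snocKernel κ n) := by
  unfold snocKernel
  exact Kernel.IsMarkovKernel.map _ (measurable_snoc n)

instance (κ : ℕ → Kernel E E) [∀ t, IsMarkovKernel (κ t)] (n : ℕ) :
    IsMarkovKernel (pathKernel κ n) := by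
  induction n with
  | zero => unfold pathKernel; infer_instance
  | succ n ih => unfold pathKernel; infer_instance

lemma snocKernel_apply (κ : Kernel E E) [IsMarkovKernel κ] (n : ℕ) (p : Fin (n + 1) → E) :
    snocKernel κ n p = (κ (p (Fin.last n))).map (fun x => Fin.snoc p x) := by
  rw [snocKernel, Kernel.map_apply _ (measurable_snoc n), Kernel.prod_apply, Kernel.id_apply,
    Kernel.comap_apply, Measure.dirac_prod, Measure.map_map (measurable_snoc n) (by fun_prop)]
  rfl

lemma lintegral_snocKernel (κ : Kernel E E) [IsMarkovKernel κ] (n : ℕ) (p : Fin (n + 1) → E)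
    {F : (Fin (n + 2) → E) → ℝ≥0∞} (hF : Measurable F) :
    ∫⁻ u, F u ∂(snocKernel κ n p) = ∫⁻ x, F (Fin.snoc p x) ∂(κ (p (Fin.last n))) := by
  rw [snocKernel_apply]
  exact lintegral_map hF ((measurable_snoc n).comp measurable_prodMk_left)

lemma chainLaw_succ (μ : Measure E) (κ : ℕ → Kernel E E) [∀ t, IsMarkovKernel (κ t)] (n : ℕ) :
    chainLaw μ (fun t x => κ t x) (n + 1) =
      (chainLaw μ (fun t x => κ t x) n).bind (snocKernel (κ (n + 1)) n) := by
  rw [chainLaw]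
  congr 1
  ext1 p
  rw [snocKernel_apply]

lemma lintegral_chainLaw_succ (μ : Measure E) (κ : ℕ → Kernel E E) [∀ t, IsMarkovKernel (κ t)]
    (n : ℕ) {F : (Fin (n + 2) → E) → ℝ≥0∞} (hF : Measurable F) :
    ∫⁻ u, F u ∂(chainLaw μ (fun t x => κ t x) (n + 1)) =
      ∫⁻ p, ∫⁻ x, F (Fin.snoc p x) ∂(κ (n + 1) (p (Fin.last n)))
        ∂(chainLaw μ (fun t x => κ t x) n) := by
  rw [chainLaw_succ, Measure.lintegral_bind (Kernel.aemeasurable _) hF.aemeasurable]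
  simp_rw [lintegral_snocKernel _ _ _ hF]

lemma chainLaw_eq_bind_pathKernel (μ : Measure E) (κ : ℕ → Kernel E E)
    [∀ t, IsMarkovKernel (κ t)] (n : ℕ) :
    chainLaw μ (fun t x => κ t x) n = μ.bind (pathKernel κ n) := by
  induction n with
  | zero =>
    rw [chainLaw, pathKernel, Measure.deterministic_comp_eq_map]
  | succ n ih =>
    rw [chainLaw_succ, ih, pathKernel, Measure.comp_assoc]

lemma lintegral_pathKernel_succ (κ : ℕ → Kernel E E) [∀ t, IsMarkovKernel (κ t)]
    (n : ℕ) (x : E) {F : (Fin (n + 2) → E) → ℝ≥0∞} (hF : Measurable F) :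
    ∫⁻ u, F u ∂(pathKernel κ (n + 1) x) =
      ∫⁻ p, ∫⁻ y, F (Fin.snoc p y) ∂(κ (n + 1) (p (Fin.last n))) ∂(pathKernel κ n x) := by
  rw [pathKernel, Kernel.lintegral_comp _ _ _ hF]
  simp_rw [lintegral_snocKernel _ _ _ hF]

lemma measurable_lintegral_snoc (κ : Kernel E E) [IsMarkovKernel κ] (n : ℕ)
    {F : (Fin (n + 2) → E) → ℝ≥0∞} (hF : Measurable F) :
    Measurable fun p : Fin (n + 1) → E => ∫⁻ y, F (Fin.snoc p y) ∂(κ (p (Fin.last n))) := by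
  simp_rw [← lintegral_snocKernel κ n _ hF]
  exact hF.lintegral_kernel

lemma lintegral_pathKernel_zero (κ : ℕ → Kernel E E) (x : E)
    {F : (Fin 1 → E) → ℝ≥0∞} (hF : Measurable F) :
    ∫⁻ u, F u ∂(pathKernel κ 0 x) = F fun _ => x := by
  exact Kernel.lintegral_deterministic' (by fun_prop) hF

/-- First-step decomposition of the path law. -/
lemma lintegral_pathKernel_succ_eq_cons (κ : ℕ → Kernel E E) [∀ t, IsMarkovKernel (κ t)]
    (n : ℕ) (x : E) {F : (Fin (n + 2) → E) → ℝ≥0∞} (hF : Measurable F) :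
    ∫⁻ u, F u ∂(pathKernel κ (n + 1) x) =
      ∫⁻ y, ∫⁻ q, F (Fin.cons x q) ∂(pathKernel (fun t => κ (t + 1)) n y) ∂(κ 1 x) := by
  induction n with
  | zero =>
    have hcons (x : E) : Measurable fun q : Fin 1 → E => F (Fin.cons x q) :=
      hF.comp ((measurable_cons 0).comp measurable_prodMk_left)
    rw [lintegral_pathKernel_succ _ _ _ hF,
      lintegral_pathKernel_zero _ _ (measurable_lintegral_snoc _ _ hF)]
    simp_rw [lintegral_pathKernel_zero _ _ (hcons x)]
    refine lintegral_congr fun y => congrArg F ?_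
    ext i
    fin_cases i <;> rfl
  | succ n ih =>
    have hcons : Measurable fun q : Fin (n + 2) → E => F (Fin.cons x q) :=
      hF.comp ((measurable_cons _).comp measurable_prodMk_left)
    rw [lintegral_pathKernel_succ _ _ _ hF, ih (measurable_lintegral_snoc _ _ hF)]
    simp_rw [lintegral_pathKernel_succ _ _ _ hcons, Fin.cons_snoc_eq_snoc_cons]
    rfl

lemma lintegral_pathKernel_start (κ : ℕ → Kernel E E) [∀ t, IsMarkovKernel (κ t)] (n : ℕ) (x : E)
    {H : E → (Fin (n + 1) → E) → ℝ≥0∞} (hH : Measurable (Function.uncurry H)) :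
    ∫⁻ q, H x q ∂(pathKernel κ n x) = ∫⁻ q, H (q 0) q ∂(pathKernel κ n x) := by
  have h₁ : Measurable (H x) := hH.comp measurable_prodMk_left
  have h₂ : Measurable fun q : Fin (n + 1) → E => H (q 0) q :=
    hH.comp (g := Function.uncurry H) (f := fun q : Fin (n + 1) → E => (q 0, q)) (by fun_prop)
  cases n with
  | zero => rw [lintegral_pathKernel_zero _ _ h₁, lintegral_pathKernel_zero _ _ h₂]
  | succ n =>
    rw [lintegral_pathKernel_succ_eq_cons _ _ _ h₁, lintegral_pathKernel_succ_eq_cons _ _ _ h₂]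
    rfl

end PathKernel

lemma lintegral_lintegral_swap_of_reversible {E : Type*} [MeasurableSpace E] {μ : Measure E}
    {κ : Kernel E E} [IsMarkovKernel κ]
    (hrev : (μ.bind (fun x => (κ x).map (fun y => (x, y)))).map Prod.swap
      = μ.bind (fun x => (κ x).map (fun y => (x, y))))
    {H : E → E → ℝ≥0∞} (hH : Measurable (Function.uncurry H)) :
    ∫⁻ x, ∫⁻ y, H x y ∂(κ x) ∂μ = ∫⁻ x, ∫⁻ y, H y x ∂(κ x) ∂μ := by
  have hκ : (fun x => (κ x).map (fun y => (x, y))) = (Kernel.id ×ₖ κ) := by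
    ext1 x
    rw [Kernel.prod_apply, Kernel.id_apply, Measure.dirac_prod]
  have key {G : E × E → ℝ≥0∞} (hG : Measurable G) :
      ∫⁻ z, G z ∂(μ.bind (fun x => (κ x).map (fun y => (x, y)))) =
        ∫⁻ x, ∫⁻ y, G (x, y) ∂(κ x) ∂μ := by
    rw [Measure.lintegral_bind (hκ ▸ Kernel.aemeasurable _) hG.aemeasurable]
    exact lintegral_congr fun x => lintegral_map hG measurable_prodMk_left
  calc ∫⁻ x, ∫⁻ y, H x y ∂(κ x) ∂μ
      = ∫⁻ z, Function.uncurry H z ∂(μ.bind (fun x => (κ x).map (fun y => (x, y)))) :=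
        (key hH).symm
    _ = ∫⁻ z, Function.uncurry H z.swap ∂(μ.bind (fun x => (κ x).map (fun y => (x, y)))) := by
        conv_lhs => rw [← hrev]
        rw [lintegral_map hH measurable_swap]
    _ = ∫⁻ x, ∫⁻ y, H y x ∂(κ x) ∂μ := key (hH.comp measurable_swap)

lemma cons_rev_eq_snoc {E : Type*} (n : ℕ) (x : E) (q : Fin (n + 1) → E) :
    (fun i : Fin (n + 2) => (Fin.cons x q : Fin (n + 2) → E) i.rev) =
      Fin.snoc (fun i => q i.rev) x := by
  ext i
  induction i using Fin.lastCases with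
  | last => simp
  | cast i => simp [Fin.rev_castSucc]

/-- The reversed backward chain has density `∏ w t (u t)` with respect to the forward chain as
soon as `w t` is the density of `π (t + 1)` with respect to `π t`. -/
lemma lintegral_rev_chainLaw {E : Type*} [MeasurableSpace E] (π : ℕ → Measure E)
    (w : ℕ → E → ℝ≥0∞) (hw : ∀ t, Measurable (w t)) (κ : ℕ → Kernel E E)
    [∀ t, IsMarkovKernel (κ t)] (T : ℕ)
    (hπ : ∀ t ≤ T, π (t + 1) = (π t).withDensity (w t))
    (hrev : ∀ t, 1 ≤ t → t ≤ T →
      ((π t).bind (fun x => (κ t x).map (fun y => (x, y)))).map Prod.swap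
        = (π t).bind (fun x => (κ t x).map (fun y => (x, y))))
    {F : (Fin (T + 1) → E) → ℝ≥0∞} (hF : Measurable F) :
    ∫⁻ u, F (fun i => u i.rev) ∂(chainLaw (π (T + 1)) (fun t x => κ (T + 1 - t) x) T) =
      ∫⁻ u, (∏ t : Fin (T + 1), w t (u t)) * F u ∂(chainLaw (π 0) (fun t x => κ t x) T) := by
  induction T with
  | zero =>
    have hconst : Measurable fun (x : E) (_ : Fin 1) => x := by fun_prop
    have hFrev : Measurable fun u : Fin 1 → E => F fun i => u i.rev := hF.comp (measurable_rev 0)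
    have hwF : Measurable fun u : Fin 1 → E => (∏ t : Fin 1, w t (u t)) * F u := by fun_prop
    rw [chainLaw, chainLaw, lintegral_map hFrev hconst, lintegral_map hwF hconst, hπ 0 le_rfl]
    refine (lintegral_withDensity_eq_lintegral_mul _ (hw 0) (hFrev.comp hconst)).trans ?_
    simp
  | succ T ih =>
    have hFrev : Measurable fun u : Fin (T + 2) → E => F fun i => u i.rev :=
      hF.comp (measurable_rev (T + 1))
    have hsnoc := hF.comp (measurable_snoc (E := E) T)
    set P := pathKernel (fun t => κ (T + 1 - t)) T with hP
    have hG : Measurable fun p : Fin (T + 1) → E =>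
        ∫⁻ x, w (T + 1) x * F (Fin.snoc p x) ∂(κ (T + 1) (p (Fin.last T))) := by
      have := measurable_lintegral_snoc (κ (T + 1)) T
        (((hw (T + 1)).comp (measurable_pi_apply (Fin.last (T + 1)))).mul hF)
      simpa using this
    have hS₂ : Measurable fun a : E × (Fin (T + 1) → E) => F (Fin.snoc (fun i => a.2 i.rev) a.1) :=
      hsnoc.comp (((measurable_rev T).comp measurable_snd).prodMk measurable_fst)
    have hS (x : E) : Measurable fun q : Fin (T + 1) → E => F (Fin.snoc (fun i => q i.rev) x) :=
      hS₂.comp measurable_prodMk_left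
    have hK : Measurable fun z : E × E => ∫⁻ q, F (Fin.snoc (fun i => q i.rev) z.1) ∂(P z.2) :=
      Measurable.lintegral_kernel_prod_right' (κ := P.comap Prod.snd measurable_snd)
        (f := fun a : (E × E) × (Fin (T + 1) → E) => F (Fin.snoc (fun i => a.2 i.rev) a.1.1))
        (hS₂.comp ((measurable_fst.comp measurable_fst).prodMk measurable_snd))
    have hJ : Measurable fun z : E × E =>
        w (T + 1) z.1 * ∫⁻ q, F (Fin.snoc (fun i => q i.rev) z.1) ∂(P z.2) :=
      ((hw _).comp measurable_fst).mul hK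
    have hWS : Measurable fun a : E × (Fin (T + 1) → E) =>
        w (T + 1) a.1 * F (Fin.snoc (fun i => a.2 i.rev) a.1) :=
      ((hw _).comp measurable_fst).mul hS₂
    have hL : Measurable (Function.uncurry fun (y : E) (q : Fin (T + 1) → E) =>
        ∫⁻ x, w (T + 1) x * F (Fin.snoc (fun i => q i.rev) x) ∂(κ (T + 1) y)) :=
      Measurable.lintegral_kernel_prod_right'
        (κ := (κ (T + 1)).comap (Prod.fst : E × (Fin (T + 1) → E) → E) measurable_fst)
        (f := fun a : (E × (Fin (T + 1) → E)) × E =>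
          w (T + 1) a.2 * F (Fin.snoc (fun i => a.1.2 i.rev) a.2))
        (hWS.comp (measurable_snd.prodMk (measurable_snd.comp measurable_fst)))
    calc ∫⁻ u, F (fun i => u i.rev)
          ∂(chainLaw (π (T + 2)) (fun t x => κ (T + 2 - t) x) (T + 1))
        = ∫⁻ x, ∫⁻ y, ∫⁻ q, F (Fin.snoc (fun i => q i.rev) x) ∂(P y) ∂(κ (T + 1) x)
            ∂(π (T + 2)) := by
          rw [chainLaw_eq_bind_pathKernel _ (fun t => κ (T + 2 - t)),
            Measure.lintegral_bind (Kernel.aemeasurable _) hFrev.aemeasurable]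
          refine lintegral_congr fun x => ?_
          refine (lintegral_pathKernel_succ_eq_cons _ T x hFrev).trans ?_
          have hshift : (fun t => κ (T + 2 - (t + 1))) = fun t => κ (T + 1 - t) := by
            ext1 t
            rw [show T + 2 - (t + 1) = T + 1 - t by omega]
          simp only [cons_rev_eq_snoc, hP, hshift]
          rfl
      _ = ∫⁻ x, ∫⁻ y, w (T + 1) x * ∫⁻ q, F (Fin.snoc (fun i => q i.rev) x) ∂(P y)
            ∂(κ (T + 1) x) ∂(π (T + 1)) := by
          rw [hπ (T + 1) le_rfl, lintegral_withDensity_eq_lintegral_mul _ (hw (T + 1))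
            (hK.lintegral_kernel_prod_right' (κ := κ (T + 1)))]
          refine lintegral_congr fun x => ?_
          exact (lintegral_const_mul _ (hK.comp measurable_prodMk_left)).symm
      _ = ∫⁻ y, ∫⁻ x, w (T + 1) x * ∫⁻ q, F (Fin.snoc (fun i => q i.rev) x) ∂(P y)
            ∂(κ (T + 1) y) ∂(π (T + 1)) :=
          lintegral_lintegral_swap_of_reversible (hrev (T + 1) (by omega) le_rfl) hJ
      _ = ∫⁻ y, ∫⁻ q, ∫⁻ x, w (T + 1) x * F (Fin.snoc (fun i => q i.rev) x)
            ∂(κ (T + 1) y) ∂(P y) ∂(π (T + 1)) := by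
          refine lintegral_congr fun y => ?_
          simp_rw [← lintegral_const_mul _ (hS _)]
          exact lintegral_lintegral_swap hWS.aemeasurable
      _ = ∫⁻ y, ∫⁻ q, ∫⁻ x, w (T + 1) x * F (Fin.snoc (fun i => q i.rev) x)
            ∂(κ (T + 1) (q 0)) ∂(P y) ∂(π (T + 1)) := by
          refine lintegral_congr fun y => ?_
          exact lintegral_pathKernel_start _ T y hL
      _ = ∫⁻ q, ∫⁻ x, w (T + 1) x * F (Fin.snoc (fun i => q i.rev) x)
            ∂(κ (T + 1) (q 0)) ∂(chainLaw (π (T + 1)) (fun t x => κ (T + 1 - t) x) T) := by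
          rw [chainLaw_eq_bind_pathKernel _ (fun t => κ (T + 1 - t)),
            Measure.lintegral_bind (Kernel.aemeasurable _)]
          simpa [Function.comp_def] using (hG.comp (measurable_rev T)).aemeasurable
      _ = ∫⁻ u, (∏ t : Fin (T + 1), w t (u t)) *
            ∫⁻ x, w (T + 1) x * F (Fin.snoc u x) ∂(κ (T + 1) (u (Fin.last T)))
            ∂(chainLaw (π 0) (fun t x => κ t x) T) := by
          rw [← ih (fun t ht => hπ t (by omega)) (fun t h1 ht => hrev t h1 (by omega)) hG]
          simp
      _ = _ := by
          have hwF : Measurable fun u : Fin (T + 2) → E =>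
              (∏ t : Fin (T + 2), w t (u t)) * F u := by fun_prop
          rw [lintegral_chainLaw_succ _ _ _ hwF]
          refine lintegral_congr fun u => ?_
          have hsnoc' : Measurable fun x => w (T + 1) x * F (Fin.snoc u x) :=
            (hw _).mul (hsnoc.comp measurable_prodMk_left)
          rw [← lintegral_const_mul _ hsnoc']
          refine lintegral_congr fun x => ?_
          simp [Fin.prod_univ_castSucc, mul_assoc]

/-- **Annealed importance sampling identity in unnormalised-density form
(Proposition 1 / `prop: AIS MCMC for doubly intractable models` of Andrieu, Doucet,
Yıldırım & Chopin).**

Let `λ` be σ-finite on `Y`, `f 0, …, f (T+1) : Y → [0,∞)` measurable with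
`0 < C t = ∫ f t dλ < ∞` and consecutive equal supports, `π t = C t⁻¹ f t ⬝ λ`, and
`R 1, …, R T` Markov kernels with `R t` reversible w.r.t. `π t`.  With forward law
`Q(du) = π 0(du₀) ∏ₜ R t(u_{t-1}, du_t)`, backward law
`Q'(du) = π (T+1)(du₀) ∏ₜ R (T+1-t)(u_{t-1}, du_t)` and `R` the order-reversing map,
`R_* Q' = Q.withDensity (u ↦ (C 0 / C (T+1)) ∏_{t=0}^{T} f (t+1) (u t) / f t (u t))`;
in particular `R_* Q' ≪ Q` with that Radon–Nikodym derivative. -/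
theorem ais_unnormalised_identity {Y : Type*} [MeasurableSpace Y]
    (lam : Measure Y) [SigmaFinite lam] (T : ℕ)
    (f : ℕ → Y → ℝ) (hfm : ∀ t, Measurable (f t)) (hf0 : ∀ t y, 0 ≤ f t y)
    (C : ℕ → ℝ≥0∞) (hC : ∀ t, C t = ∫⁻ y, ENNReal.ofReal (f t y) ∂lam)
    (hCpos : ∀ t ≤ T + 1, 0 < C t) (hCfin : ∀ t ≤ T + 1, C t ≠ ⊤)
    (hsupp : ∀ t ≤ T, lam (symmDiff {y | 0 < f t y} {y | 0 < f (t + 1) y}) = 0)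
    (πm : ℕ → Measure Y)
    (hπm : ∀ t, πm t = lam.withDensity (fun y => ENNReal.ofReal (f t y) / C t))
    (R : ℕ → Kernel Y Y) [∀ t, IsMarkovKernel (R t)]
    (hrev : ∀ t, 1 ≤ t → t ≤ T →
      ((πm t).bind (fun x => ((R t) x).map (fun y => (x, y)))).map Prod.swap
        = (πm t).bind (fun x => ((R t) x).map (fun y => (x, y)))) :
    (chainLaw (πm (T + 1)) (fun t x => (R (T + 1 - t)) x) T).map
        (fun u (i : Fin (T + 1)) => u i.rev)
      = (chainLaw (πm 0) (fun t x => (R t) x) T).withDensity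
          (fun u => (C 0 / C (T + 1)) * ∏ t : Fin (T + 1),
            ENNReal.ofReal (f ((t : ℕ) + 1) (u t)) / ENNReal.ofReal (f (t : ℕ) (u t)))
    ∧ (chainLaw (πm (T + 1)) (fun t x => (R (T + 1 - t)) x) T).map
        (fun u (i : Fin (T + 1)) => u i.rev)
      ≪ chainLaw (πm 0) (fun t x => (R t) x) T := by
  have hg (t : ℕ) : Measurable fun y => ENNReal.ofReal (f t y) := (hfm t).ennreal_ofReal
  set w : ℕ → Y → ℝ≥0∞ := fun t y =>
    C t / C (t + 1) * (ENNReal.ofReal (f (t + 1) y) / ENNReal.ofReal (f t y)) with hw_def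
  have hw (t : ℕ) : Measurable (w t) := ((hg (t + 1)).div (hg t)).const_mul _
  have hπ (t : ℕ) (ht : t ≤ T) : πm (t + 1) = (πm t).withDensity (w t) := by
    rw [hπm, hπm, ← withDensity_mul _ ((hg t).div_const _) (hw t)]
    refine withDensity_congr_ae ?_
    filter_upwards [measure_eq_zero_iff_ae_notMem.1 (hsupp t ht)] with y hy
    have hC0 := (hCpos t (by omega)).ne'
    have hCt := hCfin t (by omega)
    simp only [Set.mem_symmDiff, Set.mem_ofPred_eq, not_or, not_and, not_not] at hy
    rcases (hf0 t y).eq_or_lt with h | h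
    · have h' : f (t + 1) y = 0 := le_antisymm (not_lt.1 fun h' => (hy.2 h').ne h) (hf0 _ _)
      simp [hw_def, ← h, h']
    · have ha : ENNReal.ofReal (f t y) ≠ 0 := (ENNReal.ofReal_pos.2 h).ne'
      simp only [hw_def, Pi.mul_apply, div_eq_mul_inv]
      calc ENNReal.ofReal (f (t + 1) y) * (C (t + 1))⁻¹
          = (ENNReal.ofReal (f t y) * (ENNReal.ofReal (f t y))⁻¹) * (C t * (C t)⁻¹) *
              (ENNReal.ofReal (f (t + 1) y) * (C (t + 1))⁻¹) := by
            rw [ENNReal.mul_inv_cancel ha ENNReal.ofReal_ne_top, ENNReal.mul_inv_cancel hC0 hCt,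
              one_mul, one_mul]
        _ = _ := by ring
  have hprod (n : ℕ) (hn : n ≤ T) :
      ∏ t : Fin (n + 1), C (t : ℕ) / C ((t : ℕ) + 1) = C 0 / C (n + 1) := by
    induction n with
    | zero => simp
    | succ n ih =>
      rw [Fin.prod_univ_castSucc]
      simp only [Fin.val_castSucc, Fin.val_last]
      rw [ih (by omega), div_eq_mul_inv, div_eq_mul_inv, div_eq_mul_inv, mul_assoc,
        ENNReal.inv_mul_cancel_left (hCpos _ (by omega)).ne' (hCfin _ (by omega))]
  have hmain : (chainLaw (πm (T + 1)) (fun t x => (R (T + 1 - t)) x) T).map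
        (fun u (i : Fin (T + 1)) => u i.rev)
      = (chainLaw (πm 0) (fun t x => (R t) x) T).withDensity
          (fun u => (C 0 / C (T + 1)) * ∏ t : Fin (T + 1),
            ENNReal.ofReal (f ((t : ℕ) + 1) (u t)) / ENNReal.ofReal (f (t : ℕ) (u t))) := by
    have hD (u : Fin (T + 1) → Y) : (C 0 / C (T + 1)) * ∏ t : Fin (T + 1),
        ENNReal.ofReal (f ((t : ℕ) + 1) (u t)) / ENNReal.ofReal (f (t : ℕ) (u t)) =
          ∏ t : Fin (T + 1), w t (u t) := by
      rw [← hprod T le_rfl, ← Finset.prod_mul_distrib]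
    simp_rw [hD]
    have hDm : Measurable fun u : Fin (T + 1) → Y => ∏ t : Fin (T + 1), w t (u t) :=
      Finset.measurable_prod _ fun t _ => (hw t).comp (measurable_pi_apply t)
    refine Measure.ext_of_lintegral _ fun F hF => ?_
    rw [lintegral_map hF (measurable_rev T), lintegral_rev_chainLaw πm w hw R T hπ hrev hF,
      lintegral_withDensity_eq_lintegral_mul _ hDm hF]
    rfl
  exact ⟨hmain, hmain ▸ withDensity_absolutelyContinuous _ _⟩
end

section
/- The backward measure M← equals the forward measure M→ weighted by the annealed-importance-sampling density: M← = M→ . withDensity( (z, u, z') ↦ (C₀/C_{T+1}) ∏_{t=0}^{T} f_{t+1}(u_t)/f_t(u_t) ); equivalently, π_{T+1}(dz') R'(z', du_T) ∏_{t=T}^{1} R_t(u_t, du_{t−1}) R(u₀, dz) = (C₀/C_{T+1}) ∏_{t=0}^{T} [f_{t+1}(u_t)/f_t(u_t)] · π₀(dz) R(z, du₀) ∏_{t=1}^{T} R_t(u_{t−1}, du_t) R'(u_T, dz'). -/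
open MeasureTheory ProbabilityTheory
open scoped ENNReal

namespace ProbabilityTheory

open Measure

section Measurability

variable {α β γ δ : Type*} [MeasurableSpace α] [MeasurableSpace β] [MeasurableSpace γ]
  [MeasurableSpace δ]

theorem _root_.Measurable.finSnoc {n : ℕ} {f : α → Fin n → β} {g : α → β}
    (hf : Measurable f) (hg : Measurable g) :
    Measurable fun a => (Fin.snoc (f a) (g a) : Fin (n + 1) → β) := by
  refine measurable_pi_iff.2 fun i => ?_
  cases i using Fin.lastCases with
  | last => simpa using hg
  | cast j => simpa using measurable_pi_iff.1 hf j

theorem _root_.Measurable.finCons {n : ℕ} {f : α → β} {g : α → Fin n → β}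
    (hf : Measurable f) (hg : Measurable g) :
    Measurable fun a => (Fin.cons (f a) (g a) : Fin (n + 1) → β) := by
  refine measurable_pi_iff.2 fun i => ?_
  cases i using Fin.cases with
  | zero => simpa using hf
  | succ j => simpa using measurable_pi_iff.1 hg j

theorem _root_.Measurable.comp_finRev {n : ℕ} {f : α → Fin n → β} (hf : Measurable f) :
    Measurable fun a => f a ∘ Fin.rev :=
  measurable_pi_iff.2 fun i => measurable_pi_iff.1 hf i.rev

theorem Kernel.lintegral_comp_measurable (κ : Kernel β γ) [IsSFiniteKernel κ]
    {φ : α → β} (hφ : Measurable φ) {g : α → γ → ℝ≥0∞}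
    (hg : Measurable (Function.uncurry g)) :
    Measurable fun a => ∫⁻ c, g a c ∂κ (φ a) :=
  Measurable.lintegral_kernel_prod_right (κ := κ.comap φ hφ) hg

theorem Kernel.map_section_measurable (κ : Kernel β γ) [IsSFiniteKernel κ]
    {φ : α → β} (hφ : Measurable φ) {h : α → γ → δ}
    (hh : Measurable (Function.uncurry h)) :
    Measurable fun a => (κ (φ a)).map (h a) := by
  refine measurable_of_measurable_coe _ fun s hs => ?_
  have (a : α) : (κ (φ a)).map (h a) s
      = κ.comap φ hφ a (Prod.mk a ⁻¹' (Function.uncurry h ⁻¹' s)) :=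
    Measure.map_apply hh.of_uncurry_left hs
  simp_rw [this]
  exact Kernel.measurable_kernel_prodMk_left (hh hs)

theorem Kernel.bind_section_measurable (κ : Kernel β γ) [IsSFiniteKernel κ]
    {φ : α → β} (hφ : Measurable φ) {h : α → γ → Measure δ}
    (hh : Measurable (Function.uncurry h)) :
    Measurable fun a => (κ (φ a)).bind (h a) := by
  refine measurable_of_measurable_coe _ fun s hs => ?_
  have (a : α) : (κ (φ a)).bind (h a) s = ∫⁻ c, h a c s ∂κ (φ a) :=
    Measure.bind_apply hs hh.of_uncurry_left.aemeasurable
  simp_rw [this]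
  exact κ.lintegral_comp_measurable hφ ((Measure.measurable_coe hs).comp hh)

end Measurability

section Reversibility

variable {E : Type*} [MeasurableSpace E]

theorem lintegral_swap_of_reversible {μ : Measure E} {κ : Kernel E E} [IsSFiniteKernel κ]
    (h : (μ.bind fun x => (κ x).map fun y => (x, y)).map Prod.swap
      = μ.bind fun x => (κ x).map fun y => (x, y))
    {g : E → E → ℝ≥0∞} (hg : Measurable (Function.uncurry g)) :
    ∫⁻ x, ∫⁻ y, g x y ∂κ x ∂μ = ∫⁻ x, ∫⁻ y, g y x ∂κ x ∂μ := by
  have hm : Measurable fun x => (κ x).map fun y => (x, y) :=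
    κ.map_section_measurable measurable_id measurable_id
  have key {k : E × E → ℝ≥0∞} (hk : Measurable k) :
      ∫⁻ p, k p ∂(μ.bind fun x => (κ x).map fun y => (x, y)) = ∫⁻ x, ∫⁻ y, k (x, y) ∂κ x ∂μ := by
    rw [lintegral_bind hm.aemeasurable hk.aemeasurable]
    exact lintegral_congr fun x => lintegral_map hk measurable_prodMk_left
  have h1 := key hg
  rw [← h, lintegral_map hg measurable_swap] at h1
  exact h1.symm.trans (key (hg.comp measurable_swap))

end Reversibility

section Chain

variable {E : Type*} [MeasurableSpace E] (κ : ℕ → Kernel E E) [∀ t, IsMarkovKernel (κ t)]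

theorem measurable_map_snoc (n : ℕ) :
    Measurable fun p : Fin (n + 1) → E =>
      (κ (n + 1) (p (Fin.last n))).map fun x => (Fin.snoc p x : Fin (n + 2) → E) :=
  (κ (n + 1)).map_section_measurable (measurable_pi_apply _)
    (measurable_fst.finSnoc measurable_snd)

/-- The Markov kernel sending `x` to the law of the chain with transition kernels `κ` started
at `x`. -/
noncomputable def chainKernel (n : ℕ) : Kernel E (Fin (n + 1) → E) where
  toFun x := chainLaw (dirac x) (fun t => κ t) n
  measurable' := by
    induction n with
    | zero =>
      exact (measurable_map _ (measurable_pi_iff.2 fun _ => measurable_id)).comp measurable_dirac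
    | succ n ih => exact (measurable_bind' (measurable_map_snoc κ n)).comp ih

theorem chainKernel_apply (n : ℕ) (x : E) :
    chainKernel κ n x = chainLaw (dirac x) (fun t => κ t) n := rfl

theorem lintegral_chainKernel_zero (x : E) {g : (Fin 1 → E) → ℝ≥0∞} (hg : Measurable g) :
    ∫⁻ v, g v ∂chainKernel κ 0 x = g fun _ => x := by
  have hm : Measurable fun (x : E) (_ : Fin 1) => x := measurable_pi_iff.2 fun _ => measurable_id
  rw [chainKernel_apply, chainLaw, lintegral_map hg hm]
  exact lintegral_dirac' _ (hg.comp hm)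

theorem lintegral_chainKernel_succ (n : ℕ) (x : E) {g : (Fin (n + 2) → E) → ℝ≥0∞}
    (hg : Measurable g) :
    ∫⁻ v, g v ∂chainKernel κ (n + 1) x
      = ∫⁻ p, ∫⁻ y, g (Fin.snoc p y) ∂κ (n + 1) (p (Fin.last n)) ∂chainKernel κ n x := by
  rw [chainKernel_apply, chainLaw,
    lintegral_bind (measurable_map_snoc κ n).aemeasurable hg.aemeasurable]
  exact lintegral_congr fun p => lintegral_map hg (measurable_const.finSnoc measurable_id)

instance (n : ℕ) : IsMarkovKernel (chainKernel κ n) := by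
  refine ⟨fun x => ⟨?_⟩⟩
  rw [← lintegral_one]
  induction n with
  | zero => exact lintegral_chainKernel_zero κ x measurable_const
  | succ n ih => rw [lintegral_chainKernel_succ κ n x measurable_const]; simpa using ih

theorem measurable_lintegral_snoc {α : Type*} [MeasurableSpace α] (n : ℕ)
    {g : α → (Fin (n + 2) → E) → ℝ≥0∞} (hg : Measurable (Function.uncurry g)) :
    Measurable (Function.uncurry fun (a : α) (p : Fin (n + 1) → E) =>
      ∫⁻ y, g a (Fin.snoc p y) ∂κ (n + 1) (p (Fin.last n))) := by
  refine (κ (n + 1)).lintegral_comp_measurable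
    ((measurable_pi_apply (Fin.last n)).comp measurable_snd) ?_
  exact hg.comp ((measurable_fst.comp measurable_fst).prodMk
    ((measurable_snd.comp measurable_fst).finSnoc measurable_snd))

/-- The chain started at `x` has `x` as its first state. -/
theorem lintegral_chainKernel_apply_zero (n : ℕ) (x : E) {g : E → (Fin (n + 1) → E) → ℝ≥0∞}
    (hg : Measurable (Function.uncurry g)) :
    ∫⁻ v, g (v 0) v ∂chainKernel κ n x = ∫⁻ v, g x v ∂chainKernel κ n x := by
  have hdiag {m : ℕ} {k : E → (Fin (m + 1) → E) → ℝ≥0∞} (hk : Measurable (Function.uncurry k)) :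
      Measurable fun v => k (v 0) v :=
    hk.comp (f := fun v : Fin (m + 1) → E => (v 0, v))
      ((measurable_pi_apply 0).prodMk measurable_id)
  induction n with
  | zero =>
    rw [lintegral_chainKernel_zero κ x (hdiag hg),
      lintegral_chainKernel_zero κ x hg.of_uncurry_left]
  | succ n ih =>
    rw [lintegral_chainKernel_succ κ n x (hdiag hg),
      lintegral_chainKernel_succ κ n x hg.of_uncurry_left,
      ← ih (measurable_lintegral_snoc κ n hg)]
    refine lintegral_congr fun p => lintegral_congr fun y => ?_
    rw [show (Fin.snoc p y : Fin (n + 2) → E) 0 = p 0 from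
      Fin.snoc_castSucc (α := fun _ => E) y p 0]

/-- First-step decomposition of the chain. -/
theorem lintegral_chainKernel_succ_eq_cons (n : ℕ) (x : E) {g : (Fin (n + 2) → E) → ℝ≥0∞}
    (hg : Measurable g) :
    ∫⁻ v, g v ∂chainKernel κ (n + 1) x
      = ∫⁻ y, ∫⁻ v, g (Fin.cons x v) ∂chainKernel (fun t => κ (t + 1)) n y ∂κ 1 x := by
  induction n with
  | zero =>
    have hc : Measurable fun v : Fin 1 → E => g (Fin.cons x v) :=
      hg.comp (measurable_const.finCons measurable_id)
    have hs : Measurable fun p : Fin 1 → E =>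
        ∫⁻ y, g (Fin.snoc p y) ∂κ (0 + 1) (p (Fin.last 0)) :=
      (κ (0 + 1)).lintegral_comp_measurable (measurable_pi_apply _)
        (hg.comp (measurable_fst.finSnoc measurable_snd))
    rw [lintegral_chainKernel_succ κ 0 x hg, lintegral_chainKernel_zero κ x hs]
    refine lintegral_congr fun y => ?_
    rw [lintegral_chainKernel_zero _ y hc]
    congr 1
    ext i
    fin_cases i <;> rfl
  | succ n ih =>
    have hs : Measurable fun p : Fin (n + 2) → E =>
        ∫⁻ y, g (Fin.snoc p y) ∂κ (n + 1 + 1) (p (Fin.last (n + 1))) :=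
      (κ (n + 1 + 1)).lintegral_comp_measurable (measurable_pi_apply _)
        (hg.comp (measurable_fst.finSnoc measurable_snd))
    rw [lintegral_chainKernel_succ κ (n + 1) x hg, ih hs]
    refine lintegral_congr fun y => ?_
    have hc : Measurable fun v : Fin (n + 2) → E => g (Fin.cons x v) :=
      hg.comp (measurable_const.finCons measurable_id)
    rw [lintegral_chainKernel_succ _ n y hc]
    refine lintegral_congr fun v => ?_
    rw [← Fin.succ_last, Fin.cons_succ]
    simp_rw [Fin.cons_snoc_eq_snoc_cons]

/-- Unnormalised annealed importance sampling: if `π (t + 1)` has density `r t` with respect to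
`π t` and each `R t` is `π t`-reversible, then the time reversal of the chain started from
`π (n + 1)` and run with the kernels in decreasing order is the chain started from `π 0`, weighted
by the product of the densities along the path. -/
theorem lintegral_chainKernel_reverse (π : ℕ → Measure E) [∀ t, SFinite (π t)]
    (r : ℕ → E → ℝ≥0∞) (hr : ∀ t, Measurable (r t)) (R : ℕ → Kernel E E)
    [∀ t, IsMarkovKernel (R t)] (n : ℕ) (hπ : ∀ t ≤ n, π (t + 1) = (π t).withDensity (r t))
    (hrev : ∀ t, 1 ≤ t → t ≤ n →
      ((π t).bind fun x => (R t x).map fun y => (x, y)).map Prod.swap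
        = (π t).bind fun x => (R t x).map fun y => (x, y))
    {g : (Fin (n + 1) → E) → ℝ≥0∞} (hg : Measurable g) :
    ∫⁻ x, ∫⁻ v, g (v ∘ Fin.rev) ∂chainKernel (fun t => R (n + 1 - t)) n x ∂π (n + 1)
      = ∫⁻ x, ∫⁻ u, (∏ t : Fin (n + 1), r t (u t)) * g u ∂chainKernel R n x ∂π 0 := by
  have hw (m : ℕ) : Measurable fun u : Fin (m + 1) → E => ∏ t : Fin (m + 1), r t (u t) :=
    Finset.measurable_prod _ fun t _ => (hr t).comp (measurable_pi_apply t)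
  have hgr : Measurable fun v => g (v ∘ Fin.rev) := hg.comp (Measurable.comp_finRev measurable_id)
  induction n with
  | zero =>
    have hm : Measurable fun x : E => g ((fun _ : Fin 1 => x) ∘ Fin.rev) :=
      hgr.comp (measurable_pi_iff.2 fun _ => measurable_id)
    simp_rw [lintegral_chainKernel_zero _ _ hgr]
    refine Eq.trans ?_
      (lintegral_congr fun x => (lintegral_chainKernel_zero R x ((hw 0).mul hg)).symm)
    rw [hπ 0 le_rfl, lintegral_withDensity_eq_lintegral_mul _ (hr 0) hm]
    refine lintegral_congr fun x => ?_
    simp [Function.comp_def]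
  | succ n ih =>
    set B : Kernel E (Fin (n + 1) → E) := chainKernel (fun t => R (n + 1 - t)) n with hB
    have hsn : Measurable fun q : (Fin (n + 1) → E) × E =>
        (Fin.snoc q.1 q.2 : Fin (n + 2) → E) := measurable_fst.finSnoc measurable_snd
    have hG : Measurable (Function.uncurry fun (x : E) (v : Fin (n + 1) → E) =>
        g (Fin.snoc (v ∘ Fin.rev) x)) :=
      hg.comp (measurable_snd.comp_finRev.finSnoc measurable_fst)
    have hstep (x : E) : ∫⁻ v, g (v ∘ Fin.rev) ∂chainKernel (fun t => R (n + 1 + 1 - t)) (n + 1) x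
        = ∫⁻ y, ∫⁻ v, g (Fin.snoc (v ∘ Fin.rev) x) ∂B y ∂(R (n + 1) x) := by
      rw [lintegral_chainKernel_succ_eq_cons _ n x hgr]
      simp_rw [Fin.cons_comp_rev]
      simp [hB, Nat.add_sub_add_right]
    have hBm : Measurable (Function.uncurry fun x y =>
        ∫⁻ v, g (Fin.snoc (v ∘ Fin.rev) x) ∂B y) :=
      B.lintegral_comp_measurable measurable_snd
        (hG.comp ((measurable_fst.comp measurable_fst).prodMk measurable_snd))
    have hk : Measurable fun u : Fin (n + 1) → E =>
        ∫⁻ x, r (n + 1) x * g (Fin.snoc u x) ∂(R (n + 1) (u (Fin.last n))) :=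
      (R (n + 1)).lintegral_comp_measurable (measurable_pi_apply _)
        (((hr _).comp measurable_snd).mul (hg.comp hsn))
    calc
      _ = ∫⁻ x, ∫⁻ y, r (n + 1) x * ∫⁻ v, g (Fin.snoc (v ∘ Fin.rev) x) ∂B y ∂(R (n + 1) x)
            ∂π (n + 1) := by
        simp_rw [hstep]
        rw [hπ (n + 1) le_rfl, lintegral_withDensity_eq_lintegral_mul _ (hr _)
          hBm.lintegral_kernel_prod_right]
        refine lintegral_congr fun x => ?_
        rw [lintegral_const_mul _ hBm.of_uncurry_left]
        rfl
      _ = ∫⁻ y, ∫⁻ x, r (n + 1) x * ∫⁻ v, g (Fin.snoc (v ∘ Fin.rev) x) ∂B y ∂(R (n + 1) y)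
            ∂π (n + 1) :=
        lintegral_swap_of_reversible (hrev (n + 1) (Nat.le_add_left 1 n) le_rfl)
          (((hr _).comp measurable_fst).mul hBm)
      _ = ∫⁻ y, ∫⁻ v, ∫⁻ x, r (n + 1) x * g (Fin.snoc (v ∘ Fin.rev) x) ∂(R (n + 1) y) ∂B y
            ∂π (n + 1) := by
        refine lintegral_congr fun y => ?_
        rw [lintegral_lintegral_swap]
        · refine lintegral_congr fun x => ?_
          rw [lintegral_const_mul _ hG.of_uncurry_left]
        · exact (((hr _).comp measurable_snd).mul (hG.comp measurable_swap)).aemeasurable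
      _ = ∫⁻ y, ∫⁻ v, ∫⁻ x, r (n + 1) x * g (Fin.snoc (v ∘ Fin.rev) x) ∂(R (n + 1) (v 0)) ∂B y
            ∂π (n + 1) := by
        refine lintegral_congr fun y => ?_
        refine (lintegral_chainKernel_apply_zero _ n y (g := fun y v =>
          ∫⁻ x, r (n + 1) x * g (Fin.snoc (v ∘ Fin.rev) x) ∂(R (n + 1) y)) ?_).symm
        exact (R (n + 1)).lintegral_comp_measurable measurable_fst
          (((hr _).comp measurable_snd).mul
            (hG.comp (measurable_snd.prodMk (measurable_snd.comp measurable_fst))))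
      _ = ∫⁻ x, ∫⁻ u, (∏ t : Fin (n + 1), r t (u t)) *
            ∫⁻ y, r (n + 1) y * g (Fin.snoc u y) ∂(R (n + 1) (u (Fin.last n)))
            ∂chainKernel R n x ∂π 0 := by
        rw [← ih (fun t ht => hπ t (by lia)) (fun t h1 ht => hrev t h1 (by lia)) hk
          (hk.comp (Measurable.comp_finRev measurable_id))]
        simp [hB]
      _ = _ := by
        refine lintegral_congr fun x => ?_
        refine Eq.trans ?_ (lintegral_chainKernel_succ R n x ((hw (n + 1)).mul hg)).symm
        refine lintegral_congr fun u => ?_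
        refine (lintegral_const_mul _ ((hr _).mul
          (hg.comp (measurable_const.finSnoc measurable_id)))).symm.trans ?_
        refine lintegral_congr fun y => ?_
        simp [Fin.prod_univ_castSucc, mul_assoc]

end Chain

theorem withDensity_ofReal_div_eq {Y : Type*} [MeasurableSpace Y] (lam : Measure Y)
    {f g : Y → ℝ} (hf : Measurable f) (hg : Measurable g) {c d : ℝ≥0∞} (hc : c ≠ 0) (hc' : c ≠ ⊤)
    (hsupp : lam (symmDiff {y | 0 < f y} {y | 0 < g y}) = 0) :
    lam.withDensity (fun y => ENNReal.ofReal (g y) / d)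
      = (lam.withDensity fun y => ENNReal.ofReal (f y) / c).withDensity
          fun y => c / d * (ENNReal.ofReal (g y) / ENNReal.ofReal (f y)) := by
  rw [← withDensity_mul _ (by fun_prop) (by fun_prop)]
  refine withDensity_congr_ae ?_
  filter_upwards [measure_eq_zero_iff_ae_notMem.1 hsupp] with y hy
  simp only [Set.mem_symmDiff, Set.mem_ofPred_eq, Pi.mul_apply] at hy ⊢
  rcases lt_or_ge 0 (f y) with hfy | hfy
  · have h0 : ENNReal.ofReal (f y) ≠ 0 := by simpa using hfy
    calc
      _ = (c * c⁻¹) * (ENNReal.ofReal (f y) * (ENNReal.ofReal (f y))⁻¹)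
            * (ENNReal.ofReal (g y) * d⁻¹) := by
        rw [ENNReal.mul_inv_cancel hc hc', ENNReal.mul_inv_cancel h0 ENNReal.ofReal_ne_top]
        simp [div_eq_mul_inv]
      _ = _ := by simp only [div_eq_mul_inv]; ring
  · have hgy : g y ≤ 0 := by grind
    simp [ENNReal.ofReal_of_nonpos hfy, ENNReal.ofReal_of_nonpos hgy]

theorem _root_.ENNReal.prod_div_succ (C : ℕ → ℝ≥0∞) (n : ℕ) (h0 : ∀ t ≤ n, C t ≠ 0)
    (htop : ∀ t ≤ n, C t ≠ ⊤) :
    ∏ t : Fin (n + 1), C t / C (t + 1) = C 0 / C (n + 1) := by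
  induction n with
  | zero => simp
  | succ n ih =>
    rw [Fin.prod_univ_castSucc]
    simp only [Fin.val_castSucc, Fin.val_last]
    rw [ih (fun t ht => h0 t (by lia)) (fun t ht => htop t (by lia)), div_eq_mul_inv,
      div_eq_mul_inv, div_eq_mul_inv, mul_assoc, ← mul_assoc (C (n + 1))⁻¹,
      ENNReal.inv_mul_cancel (h0 _ le_rfl) (htop _ le_rfl), one_mul]

end ProbabilityTheory

/-- **The AIS-within-Metropolis–Hastings identity (Proposition 2 /
`prop:MHwithAISinside` of Andrieu, Doucet, Yıldırım & Chopin).**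

In the setting of the unnormalised AIS identity, with two additional Markov kernels
`R₀` (reversible w.r.t. `π 0`) and `R'` (reversible w.r.t. `π (T+1)`), the backward
measure `M←(d(z,u,z')) = π (T+1)(dz') R'(z',du_T) ∏_{t=T}^{1} R t(u_t,du_{t-1}) R₀(u₀,dz)`
equals the forward measure
`M→(d(z,u,z')) = π 0(dz) R₀(z,du₀) ∏_{t=1}^{T} R t(u_{t-1},du_t) R'(u_T,dz')`
weighted by `(z,u,z') ↦ (C 0 / C (T+1)) ∏_{t=0}^{T} f (t+1) (u_t) / f t (u_t)`. -/
theorem ais_within_mh_identity {Y : Type*} [MeasurableSpace Y]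
    (lam : Measure Y) [SigmaFinite lam] (T : ℕ)
    (f : ℕ → Y → ℝ) (hfm : ∀ t, Measurable (f t)) (hf0 : ∀ t y, 0 ≤ f t y)
    (C : ℕ → ℝ≥0∞) (hC : ∀ t, C t = ∫⁻ y, ENNReal.ofReal (f t y) ∂lam)
    (hCpos : ∀ t ≤ T + 1, 0 < C t) (hCfin : ∀ t ≤ T + 1, C t ≠ ⊤)
    (hsupp : ∀ t ≤ T, lam (symmDiff {y | 0 < f t y} {y | 0 < f (t + 1) y}) = 0)
    (πm : ℕ → Measure Y)
    (hπm : ∀ t, πm t = lam.withDensity (fun y => ENNReal.ofReal (f t y) / C t))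
    (R : ℕ → Kernel Y Y) [∀ t, IsMarkovKernel (R t)]
    (hrev : ∀ t, 1 ≤ t → t ≤ T →
      ((πm t).bind (fun x => ((R t) x).map (fun y => (x, y)))).map Prod.swap
        = (πm t).bind (fun x => ((R t) x).map (fun y => (x, y))))
    (R0 R' : Kernel Y Y) [IsMarkovKernel R0] [IsMarkovKernel R']
    (hrev0 : ((πm 0).bind (fun x => (R0 x).map (fun y => (x, y)))).map Prod.swap
      = (πm 0).bind (fun x => (R0 x).map (fun y => (x, y))))
    (hrev' : ((πm (T + 1)).bind (fun x => (R' x).map (fun y => (x, y)))).map Prod.swap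
      = (πm (T + 1)).bind (fun x => (R' x).map (fun y => (x, y)))) :
    -- `M←`
    (πm (T + 1)).bind (fun z' => (R' z').bind (fun uT =>
        (chainLaw (Measure.dirac uT) (fun t x => (R (T + 1 - t)) x) T).bind (fun v =>
          (R0 (v (Fin.last T))).map
            (fun z => (z, fun i : Fin (T + 1) => v i.rev, z')))))
    -- `M→` weighted by the AIS density
    = ((πm 0).bind (fun z => (R0 z).bind (fun u0 =>
        (chainLaw (Measure.dirac u0) (fun t x => (R t) x) T).bind (fun u =>
          (R' (u (Fin.last T))).map (fun z' => (z, u, z')))))).withDensity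
        (fun p : Y × (Fin (T + 1) → Y) × Y =>
          (C 0 / C (T + 1)) * ∏ t : Fin (T + 1),
            ENNReal.ofReal (f ((t : ℕ) + 1) (p.2.1 t))
              / ENNReal.ofReal (f (t : ℕ) (p.2.1 t))) := by
  have hchainB (y : Y) : chainLaw (Measure.dirac y) (fun t x => R (T + 1 - t) x) T
      = chainKernel (fun t => R (T + 1 - t)) T y := rfl
  have hchainF (y : Y) : chainLaw (Measure.dirac y) (fun t x => R t x) T
      = chainKernel R T y := rfl
  simp_rw [hchainB, hchainF]
  set B := chainKernel (fun t => R (T + 1 - t)) T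
  set F := chainKernel R T
  let r (t : ℕ) (y : Y) : ℝ≥0∞ :=
    C t / C (t + 1) * (ENNReal.ofReal (f (t + 1) y) / ENNReal.ofReal (f t y))
  have hr (t : ℕ) : Measurable (r t) := by
    have := hfm t
    have := hfm (t + 1)
    fun_prop
  have hπ (t : ℕ) (ht : t ≤ T) : πm (t + 1) = (πm t).withDensity (r t) := by
    rw [hπm, hπm]
    exact withDensity_ofReal_div_eq lam (hfm t) (hfm (t + 1)) (hCpos t (by lia)).ne'
      (hCfin t (by lia)) (hsupp t ht)
  have : ∀ t, SFinite (πm t) := fun t => by rw [hπm]; infer_instance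
  have hweight (u : Fin (T + 1) → Y) : (C 0 / C (T + 1)) * ∏ t : Fin (T + 1),
      ENNReal.ofReal (f ((t : ℕ) + 1) (u t)) / ENNReal.ofReal (f (t : ℕ) (u t))
        = ∏ t : Fin (T + 1), r t (u t) := by
    rw [Finset.prod_mul_distrib, ENNReal.prod_div_succ C T (fun t ht => (hCpos t (by lia)).ne')
      (fun t ht => hCfin t (by lia))]
  simp_rw [hweight]
  have hw : Measurable fun u : Fin (T + 1) → Y => ∏ t : Fin (T + 1), r t (u t) :=
    Finset.measurable_prod _ fun t _ => (hr t).comp (measurable_pi_apply t)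
  have hB3 : Measurable (Function.uncurry fun (z' : Y) (v : Fin (T + 1) → Y) =>
      (R0 (v (Fin.last T))).map fun z => (z, (fun i : Fin (T + 1) => v i.rev), z')) :=
    R0.map_section_measurable ((measurable_pi_apply _).comp measurable_snd)
      (measurable_snd.prodMk ((measurable_snd.comp measurable_fst).comp_finRev.prodMk
        (measurable_fst.comp measurable_fst)))
  have hB2 : Measurable (Function.uncurry fun z' uT : Y => (B uT).bind fun v =>
      (R0 (v (Fin.last T))).map fun z => (z, (fun i : Fin (T + 1) => v i.rev), z')) :=
    B.bind_section_measurable measurable_snd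
      (hB3.comp ((measurable_fst.comp measurable_fst).prodMk measurable_snd))
  have hB1 : Measurable fun z' => (R' z').bind fun uT => (B uT).bind fun v =>
      (R0 (v (Fin.last T))).map fun z => (z, (fun i : Fin (T + 1) => v i.rev), z') :=
    R'.bind_section_measurable measurable_id hB2
  have hF3 : Measurable (Function.uncurry fun (z : Y) (u : Fin (T + 1) → Y) =>
      (R' (u (Fin.last T))).map fun z' => (z, u, z')) :=
    R'.map_section_measurable ((measurable_pi_apply _).comp measurable_snd)
      ((measurable_fst.comp measurable_fst).prodMk
        ((measurable_snd.comp measurable_fst).prodMk measurable_snd))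
  have hF2 : Measurable (Function.uncurry fun z u0 : Y => (F u0).bind fun u =>
      (R' (u (Fin.last T))).map fun z' => (z, u, z')) :=
    F.bind_section_measurable measurable_snd
      (hF3.comp ((measurable_fst.comp measurable_fst).prodMk measurable_snd))
  have hF1 : Measurable fun z => (R0 z).bind fun u0 => (F u0).bind fun u =>
      (R' (u (Fin.last T))).map fun z' => (z, u, z') :=
    R0.bind_section_measurable measurable_id hF2
  refine Measure.ext_of_lintegral _ fun g hg => ?_
  have hbackward : ∫⁻ p, g p ∂((πm (T + 1)).bind fun z' => (R' z').bind fun uT =>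
      (B uT).bind fun v => (R0 (v (Fin.last T))).map
        fun z => (z, (fun i : Fin (T + 1) => v i.rev), z'))
      = ∫⁻ z', ∫⁻ uT, ∫⁻ v, ∫⁻ z, g (z, v ∘ Fin.rev, z') ∂(R0 (v (Fin.last T))) ∂B uT ∂(R' z')
          ∂πm (T + 1) := by
    rw [Measure.lintegral_bind hB1.aemeasurable hg.aemeasurable]
    refine lintegral_congr fun z' => ?_
    rw [Measure.lintegral_bind hB2.of_uncurry_left.aemeasurable hg.aemeasurable]
    refine lintegral_congr fun uT => ?_
    rw [Measure.lintegral_bind hB3.of_uncurry_left.aemeasurable hg.aemeasurable]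
    exact lintegral_congr fun v => lintegral_map hg
      (measurable_id.prodMk (measurable_const.prodMk measurable_const))
  have hforward {k : Y × (Fin (T + 1) → Y) × Y → ℝ≥0∞} (hk : Measurable k) :
      ∫⁻ p, k p ∂((πm 0).bind fun z => (R0 z).bind fun u0 =>
        (F u0).bind fun u => (R' (u (Fin.last T))).map fun z' => (z, u, z'))
      = ∫⁻ z, ∫⁻ u0, ∫⁻ u, ∫⁻ z', k (z, u, z') ∂(R' (u (Fin.last T))) ∂F u0 ∂(R0 z) ∂πm 0 := by
    rw [Measure.lintegral_bind hF1.aemeasurable hk.aemeasurable]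
    refine lintegral_congr fun z => ?_
    rw [Measure.lintegral_bind hF2.of_uncurry_left.aemeasurable hk.aemeasurable]
    refine lintegral_congr fun u0 => ?_
    rw [Measure.lintegral_bind hF3.of_uncurry_left.aemeasurable hk.aemeasurable]
    exact lintegral_congr fun u => lintegral_map hk
      (measurable_const.prodMk (measurable_const.prodMk measurable_id))
  have hw' : Measurable fun p : Y × (Fin (T + 1) → Y) × Y => ∏ t : Fin (T + 1), r t (p.2.1 t) :=
    hw.comp (measurable_fst.comp measurable_snd)
  rw [lintegral_withDensity_eq_lintegral_mul _ hw' hg, hforward (hw'.mul hg), hbackward]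
  simp only [Pi.mul_apply]
  have hI0 : Measurable (Function.uncurry fun (z' : Y) (u : Fin (T + 1) → Y) =>
      ∫⁻ z, g (z, u, z') ∂(R0 (u 0))) :=
    R0.lintegral_comp_measurable ((measurable_pi_apply _).comp measurable_snd)
      (hg.comp (measurable_snd.prodMk ((measurable_snd.comp measurable_fst).prodMk
        (measurable_fst.comp measurable_fst))))
  have hI1 : Measurable (Function.uncurry fun (z : Y) (u : Fin (T + 1) → Y) =>
      ∫⁻ z', (∏ t : Fin (T + 1), r t (u t)) * g (z, u, z') ∂(R' (u (Fin.last T)))) :=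
    R'.lintegral_comp_measurable ((measurable_pi_apply _).comp measurable_snd)
      ((hw.comp (measurable_snd.comp measurable_fst)).mul
        (hg.comp ((measurable_fst.comp measurable_fst).prodMk
          ((measurable_snd.comp measurable_fst).prodMk measurable_snd))))
  have hI0r : Measurable (Function.uncurry fun (z' : Y) (v : Fin (T + 1) → Y) =>
      ∫⁻ z, g (z, v ∘ Fin.rev, z') ∂(R0 (v (Fin.last T)))) := by
    have := hI0.comp (measurable_fst.prodMk measurable_snd.comp_finRev)
    simpa [Function.comp_def, Function.uncurry_def] using this
  have hIr : Measurable (Function.uncurry fun (y : Y) (v : Fin (T + 1) → Y) =>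
      ∫⁻ z', ∫⁻ z, g (z, v ∘ Fin.rev, z') ∂(R0 (v (Fin.last T))) ∂(R' y)) :=
    R'.lintegral_comp_measurable measurable_fst
      (hI0r.comp (measurable_snd.prodMk (measurable_snd.comp measurable_fst)))
  have hI2 : Measurable fun u : Fin (T + 1) → Y =>
      ∫⁻ z', ∫⁻ z, g (z, u, z') ∂(R0 (u 0)) ∂(R' (u (Fin.last T))) :=
    R'.lintegral_comp_measurable (measurable_pi_apply _) (hI0.comp measurable_swap)
  have hgu (u : Fin (T + 1) → Y) :
      Measurable (Function.uncurry fun z z' : Y => g (z, u, z')) :=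
    hg.comp (measurable_fst.prodMk (measurable_const.prodMk measurable_snd))
  calc
    _ = ∫⁻ y, ∫⁻ z', ∫⁻ v, ∫⁻ z, g (z, v ∘ Fin.rev, z') ∂(R0 (v (Fin.last T))) ∂B y ∂(R' y)
          ∂πm (T + 1) :=
      lintegral_swap_of_reversible hrev' (B.lintegral_comp_measurable measurable_snd
        (hI0r.comp ((measurable_fst.comp measurable_fst).prodMk measurable_snd)))
    _ = ∫⁻ y, ∫⁻ v, ∫⁻ z', ∫⁻ z, g (z, v ∘ Fin.rev, z') ∂(R0 (v (Fin.last T))) ∂(R' (v 0)) ∂B y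
          ∂πm (T + 1) := by
      refine lintegral_congr fun y => ?_
      rw [lintegral_lintegral_swap hI0r.aemeasurable]
      exact (lintegral_chainKernel_apply_zero _ T y hIr).symm
    _ = ∫⁻ y, ∫⁻ u, (∏ t : Fin (T + 1), r t (u t)) *
          ∫⁻ z', ∫⁻ z, g (z, u, z') ∂(R0 (u 0)) ∂(R' (u (Fin.last T))) ∂F y ∂πm 0 := by
      rw [← lintegral_chainKernel_reverse πm r hr R T hπ hrev hI2]
      simp [B]
    _ = ∫⁻ y, ∫⁻ u, ∫⁻ z, ∫⁻ z', (∏ t : Fin (T + 1), r t (u t)) * g (z, u, z')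
          ∂(R' (u (Fin.last T))) ∂(R0 (u 0)) ∂F y ∂πm 0 := by
      refine lintegral_congr fun y => lintegral_congr fun u => ?_
      have hgs : Measurable (Function.uncurry fun z' z : Y => g (z, u, z')) :=
        (hgu u).comp measurable_swap
      rw [lintegral_lintegral_swap hgs.aemeasurable,
        ← lintegral_const_mul _ (R'.lintegral_comp_measurable measurable_const (hgu u))]
      exact lintegral_congr fun z => (lintegral_const_mul _ (hgu u).of_uncurry_left).symm
    _ = ∫⁻ y, ∫⁻ z, ∫⁻ u, ∫⁻ z', (∏ t : Fin (T + 1), r t (u t)) * g (z, u, z')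
          ∂(R' (u (Fin.last T))) ∂F y ∂(R0 y) ∂πm 0 := by
      refine lintegral_congr fun y => ?_
      rw [lintegral_lintegral_swap hI1.aemeasurable]
      refine lintegral_chainKernel_apply_zero _ T y (g := fun y u => ∫⁻ z, ∫⁻ z',
        (∏ t : Fin (T + 1), r t (u t)) * g (z, u, z') ∂(R' (u (Fin.last T))) ∂(R0 y)) ?_
      exact R0.lintegral_comp_measurable measurable_fst
        (hI1.comp (measurable_snd.prodMk (measurable_snd.comp measurable_fst)))
    _ = _ := by
      refine (lintegral_swap_of_reversible hrev0 (g := fun z y => ∫⁻ u, ∫⁻ z',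
        (∏ t : Fin (T + 1), r t (u t)) * g (z, u, z') ∂(R' (u (Fin.last T))) ∂F y) ?_).symm
      exact F.lintegral_comp_measurable measurable_snd
        (hI1.comp ((measurable_fst.comp measurable_fst).prodMk measurable_snd))
end

section
/- For every N ≥ 1, as measures on (Θ×Z) × (Θ×Z) × U^N × {1,…,N} (coordinates (x, y, 𝔲, k) with x = (θ,z), y = (θ',z')): π(dy) Q₂^N(y, d(x, 𝔲, k)) = ϱ^N(θ,θ',𝔲) · π(dx) Q₁^N(x, d(y, 𝔲, k)); consequently the MHAAR kernel on X = Θ×Z that with probability 1/2 proposes from Q₁^N and accepts with probability min{1, ϱ^N(θ,θ',𝔲)}, and with probability 1/2 proposes from Q₂^N and accepts with probability min{1, 1/ϱ^N(θ',θ,𝔲)} (convention 1/0 := 0), rejecting to the current state otherwise, satisfies detailed balance with respect to π. -/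
open MeasureTheory ProbabilityTheory
open scoped ENNReal

section MeasurableFamilies

variable {α β γ : Type*} [MeasurableSpace α] [MeasurableSpace β] [MeasurableSpace γ]

theorem measurable_lintegral_family {κ : α → Measure β} (hκ : Measurable κ)
    (hp : ∀ a, IsProbabilityMeasure (κ a)) {f : α → β → ℝ≥0∞}
    (hf : Measurable fun p : α × β => f p.1 p.2) :
    Measurable fun a => ∫⁻ b, f a b ∂(κ a) := by
  let K : Kernel α β := ⟨κ, hκ⟩
  have : IsMarkovKernel K := ⟨hp⟩
  exact Measurable.lintegral_kernel_prod_right (κ := K) hf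

theorem measurable_bind_family {κ : α → Measure β} (hκ : Measurable κ)
    (hp : ∀ a, IsProbabilityMeasure (κ a)) {η : α → β → Measure γ}
    (hη : Measurable fun p : α × β => η p.1 p.2) :
    Measurable fun a => (κ a).bind (η a) := by
  refine Measure.measurable_of_measurable_coe _ fun s hs => ?_
  have h (a : α) : (κ a).bind (η a) s = ∫⁻ b, η a b s ∂(κ a) :=
    Measure.bind_apply hs (hη.comp measurable_prodMk_left).aemeasurable
  simp_rw [h]
  exact measurable_lintegral_family hκ hp ((Measure.measurable_coe hs).comp hη)

theorem measurable_map_family {κ : α → Measure β} (hκ : Measurable κ)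
    (hp : ∀ a, IsProbabilityMeasure (κ a)) {g : α → β → γ}
    (hg : Measurable fun p : α × β => g p.1 p.2) :
    Measurable fun a => (κ a).map (g a) := by
  have h (a : α) : (κ a).map (g a) = (κ a).bind fun b => Measure.dirac (g a b) :=
    (Measure.bind_dirac_eq_map _ (hg.comp measurable_prodMk_left)).symm
  simp_rw [h]
  exact measurable_bind_family hκ hp (Measure.measurable_dirac.comp hg)

theorem measurable_finset_sum_measure {ι : Type*} (s : Finset ι) {κ : ι → α → Measure β}
    (hκ : ∀ i ∈ s, Measurable (κ i)) : Measurable fun a => ∑ i ∈ s, κ i a := by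
  refine Measure.measurable_of_measurable_coe _ fun t ht => ?_
  simp only [Measure.finsetSum_apply]
  exact Finset.measurable_sum _ fun i hi => (Measure.measurable_coe ht).comp (hκ i hi)

theorem measurable_smul_measure_family {κ : α → Measure β} (hκ : Measurable κ)
    {c : α → ℝ≥0∞} (hc : Measurable c) : Measurable fun a => c a • κ a := by
  refine Measure.measurable_of_measurable_coe _ fun t ht => ?_
  simp only [Measure.smul_apply, smul_eq_mul]
  exact hc.mul ((Measure.measurable_coe ht).comp hκ)

theorem measurable_measure_pi_family {ι : Type*} [Fintype ι] {κ : ι → α → Measure β}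
    (hκ : ∀ i, Measurable (κ i)) (hp : ∀ i a, IsProbabilityMeasure (κ i a)) :
    Measurable fun a => Measure.pi fun i => κ i a := by
  refine Measurable.measure_of_isPiSystem_of_isProbabilityMeasure
    generateFrom_pi.symm isPiSystem_pi ?_
  rintro _ ⟨s, hs, rfl⟩
  simp only [Measure.pi_pi]
  exact Finset.measurable_prod _ fun i _ =>
    (Measure.measurable_coe (hs i (Set.mem_univ i))).comp (hκ i)

theorem lintegral_bind_of_measurable {μ : Measure α} {κ : α → Measure β} (hκ : Measurable κ)
    {f : β → ℝ≥0∞} (hf : Measurable f) :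
    ∫⁻ b, f b ∂(μ.bind κ) = ∫⁻ a, ∫⁻ b, f b ∂(κ a) ∂μ :=
  Measure.lintegral_bind hκ.aemeasurable hf.aemeasurable

end MeasurableFamilies

section Resampling

variable {ι U : Type*} [Fintype ι] [MeasurableSpace U]

theorem measurable_pi_kernel_comp {Y : Type*} [MeasurableSpace Y] {Q : Kernel Y U}
    [IsMarkovKernel Q] {α : Type*} [MeasurableSpace α] {g : α → Y} (hg : Measurable g) :
    Measurable fun a => Measure.pi fun _ : ι => Q (g a) :=
  measurable_measure_pi_family (fun _ => Q.measurable.comp hg) fun _ _ => inferInstance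

variable [DecidableEq ι]

theorem isProbabilityMeasure_ite_dirac (μ : Measure U) [IsProbabilityMeasure μ] (p : Prop)
    [Decidable p] (u : U) : IsProbabilityMeasure (if p then Measure.dirac u else μ) := by
  split_ifs <;> infer_instance

theorem measurable_ite_dirac {α : Type*} [MeasurableSpace α] {κ : α → Measure U}
    (hκ : Measurable κ) {g : α → U} (hg : Measurable g) (p : Prop) [Decidable p] :
    Measurable fun a => if p then Measure.dirac (g a) else κ a := by
  split_ifs
  exacts [Measure.measurable_dirac.comp hg, hκ]

theorem pi_ite_dirac_eq_map_update (μ : Measure U) [IsProbabilityMeasure μ] (k : ι) (u : U) :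
    Measure.pi (fun i => if i = k then Measure.dirac u else μ)
      = (Measure.pi fun _ : ι => μ).map fun us => Function.update us k u := by
  have := fun i : ι => isProbabilityMeasure_ite_dirac μ (i = k) u
  have hm : Measurable fun us : ι → U => Function.update us k u := by
    fun_prop
  refine (Measure.pi_eq fun s hs => ?_)
  rw [Measure.map_apply hm (MeasurableSet.univ_pi hs)]
  by_cases hu : u ∈ s k
  · have h : (fun us : ι → U => Function.update us k u) ⁻¹' Set.univ.pi s
        = Set.univ.pi (Function.update s k Set.univ) := by
      ext us
      simp only [Set.mem_preimage, Set.mem_univ_pi]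
      refine forall_congr' fun i => ?_
      by_cases hi : i = k
      · subst hi; simp [hu]
      · simp [hi]
    rw [h, Measure.pi_pi]
    refine Finset.prod_congr rfl fun i _ => ?_
    by_cases hi : i = k
    · subst hi; simp [hs i, hu]
    · simp [hi]
  · have h : (fun us : ι → U => Function.update us k u) ⁻¹' Set.univ.pi s = ∅ := by
      ext us
      simp only [Set.mem_preimage, Set.mem_univ_pi, Set.mem_empty_iff_false, iff_false]
      intro h
      exact hu (by simpa using h k)
    rw [h, measure_empty]
    refine (Finset.prod_eq_zero (Finset.mem_univ k) ?_).symm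
    simp [hs k, hu]

theorem bind_pi_ite_dirac (μ : Measure U) [IsProbabilityMeasure μ] (k : ι) :
    (μ.bind fun u => Measure.pi fun i => if i = k then Measure.dirac u else μ)
      = Measure.pi fun _ : ι => μ := by
  have hp := fun (i : ι) (u : U) => isProbabilityMeasure_ite_dirac μ (i = k) u
  have hm : Measurable fun u => Measure.pi fun i : ι => if i = k then Measure.dirac u else μ :=
    measurable_measure_pi_family
      (fun i => measurable_ite_dirac measurable_const measurable_id (i = k)) hp
  refine (Measure.pi_eq fun s hs => ?_).symm
  rw [Measure.bind_apply (MeasurableSet.univ_pi hs) hm.aemeasurable]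
  simp only [Measure.pi_pi]
  simp only [← Finset.mul_prod_erase _ _ (Finset.mem_univ k), if_true]
  have h (u : U) : ∏ i ∈ Finset.univ.erase k,
      (if i = k then Measure.dirac u else μ) (s i) = ∏ i ∈ Finset.univ.erase k, μ (s i) :=
    Finset.prod_congr rfl fun i hi => by rw [if_neg (Finset.ne_of_mem_erase hi)]
  simp only [h]
  have hd : Measurable fun u : U => Measure.dirac u (s k) :=
    (Measure.measurable_coe (hs k)).comp Measure.measurable_dirac
  rw [lintegral_mul_const _ hd]
  congr 1
  simp only [Measure.dirac_apply' _ (hs k)]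
  rw [lintegral_indicator_one (hs k)]

theorem lintegral_lintegral_pi_ite_dirac (μ : Measure U) [IsProbabilityMeasure μ] (k : ι)
    {H : U → (ι → U) → ℝ≥0∞} (hH : Measurable fun p : U × (ι → U) => H p.1 p.2) :
    ∫⁻ u, ∫⁻ us, H u us ∂(Measure.pi fun i => if i = k then Measure.dirac u else μ) ∂μ
      = ∫⁻ us, H (us k) us ∂(Measure.pi fun _ : ι => μ) := by
  have hp := fun (i : ι) (u : U) => isProbabilityMeasure_ite_dirac μ (i = k) u
  have hm : Measurable fun u => Measure.pi fun i : ι => if i = k then Measure.dirac u else μ :=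
    measurable_measure_pi_family
      (fun i => measurable_ite_dirac measurable_const measurable_id (i = k)) hp
  have hk : Measurable fun us : ι → U => (us k, us) :=
    (measurable_pi_apply k).prodMk measurable_id
  have hdiag : Measurable fun us : ι → U => H (us k) us := hH.comp hk
  conv_rhs => rw [← bind_pi_ite_dirac μ k, lintegral_bind_of_measurable hm hdiag]
  refine lintegral_congr fun u => ?_
  have hu : Measurable fun us : ι → U => Function.update us k u := by fun_prop
  have hHu : Measurable fun us => H u us := hH.comp measurable_prodMk_left
  rw [pi_ite_dirac_eq_map_update, lintegral_map hHu hu,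
    lintegral_map hdiag hu]
  simp

theorem measurable_pi_ite_dirac_kernel_comp {Y : Type*} [MeasurableSpace Y]
    {Q : Kernel Y U} [IsMarkovKernel Q] {α : Type*} [MeasurableSpace α] {g : α → Y}
    (hg : Measurable g) {h : α → U} (hh : Measurable h) (k : ι) :
    Measurable fun a =>
      Measure.pi fun i : ι => if i = k then Measure.dirac (h a) else Q (g a) :=
  measurable_measure_pi_family
    (fun i => measurable_ite_dirac (Q.measurable.comp hg) hh (i = k))
    fun i a => isProbabilityMeasure_ite_dirac (Q (g a)) (i = k) (h a)

theorem isProbabilityMeasure_pi_ite_dirac (μ : Measure U) [IsProbabilityMeasure μ] (k : ι)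
    (u : U) : IsProbabilityMeasure
      (Measure.pi fun i : ι => if i = k then Measure.dirac u else μ) := by
  have := fun i : ι => isProbabilityMeasure_ite_dirac μ (i = k) u
  infer_instance

theorem lintegral_resample {Z : Type*} [MeasurableSpace Z] (μ : Measure U)
    [IsProbabilityMeasure μ] {η : U → Measure Z} (hη : Measurable η)
    (hηp : ∀ u, IsProbabilityMeasure (η u)) {r : U → ℝ≥0∞} (hr : Measurable r) {c : ℝ≥0∞}
    {F : Z → (ι → U) → ℝ≥0∞} (hF : Measurable fun p : Z × (ι → U) => F p.1 p.2) (k : ι)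
    {w d : (ι → U) → ℝ≥0∞} (hwd : ∀ us, w us * d us = r (us k) * c) :
    ∫⁻ u, ∫⁻ z, r u * (c * ∫⁻ us, F z us
        ∂(Measure.pi fun i => if i = k then Measure.dirac u else μ)) ∂(η u) ∂μ
      = ∫⁻ us, w us * ∫⁻ z, d us * F z us ∂(η (us k)) ∂(Measure.pi fun _ : ι => μ) := by
  have hswap : Measurable fun p : (ι → U) × Z => F p.2 p.1 := hF.comp measurable_swap
  have hFus (us : ι → U) : Measurable fun z => F z us := hswap.comp measurable_prodMk_left
  have hin : Measurable fun p : U × (ι → U) => ∫⁻ z, F z p.2 ∂(η p.1) := by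
    refine measurable_lintegral_family (hη.comp measurable_fst) (fun _ => hηp _) ?_
    exact hswap.comp (f := fun p : (U × (ι → U)) × Z => (p.1.2, p.2)) (by fun_prop)
  have hin' (u : U) : Measurable fun us => ∫⁻ z, F z us ∂(η u) :=
    hin.comp measurable_prodMk_left
  calc
    _ = ∫⁻ u, ∫⁻ us, (r u * c) * ∫⁻ z, F z us ∂(η u)
        ∂(Measure.pi fun i => if i = k then Measure.dirac u else μ) ∂μ := by
      refine lintegral_congr fun u => ?_
      have := isProbabilityMeasure_pi_ite_dirac μ k u
      have hz : Measurable fun z => ∫⁻ us, F z us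
          ∂(Measure.pi fun i => if i = k then Measure.dirac u else μ) :=
        measurable_lintegral_family measurable_const (fun _ => this) hF
      simp_rw [← mul_assoc]
      rw [lintegral_const_mul _ hz, lintegral_const_mul _ (hin' u),
        lintegral_lintegral_swap hF.aemeasurable]
    _ = ∫⁻ us, (r (us k) * c) * ∫⁻ z, F z us ∂(η (us k)) ∂(Measure.pi fun _ : ι => μ) :=
      lintegral_lintegral_pi_ite_dirac μ k
        (H := fun u us => (r u * c) * ∫⁻ z, F z us ∂(η u))
        (((hr.comp measurable_fst).mul_const c).mul hin)
    _ = _ := by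
      refine lintegral_congr fun us => ?_
      rw [lintegral_const_mul _ (hFus us), ← mul_assoc, hwd]

end Resampling

section DetailedBalance

variable {X V : Type*} [MeasurableSpace X] [MeasurableSpace V]

theorem bind_map_eq_map_compProd {Y W : Type*} [MeasurableSpace Y] [MeasurableSpace W]
    (μ : Measure X) [SFinite μ] (K : Kernel X Y) [IsMarkovKernel K] {g : X → Y → W}
    (hg : Measurable fun p : X × Y => g p.1 p.2) :
    (μ.bind fun x => (K x).map (g x)) = (μ ⊗ₘ K).map fun p => g p.1 p.2 := by
  have hm : Measurable fun x => (K x).map (g x) :=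
    measurable_map_family K.measurable (fun _ => inferInstance) hg
  ext s hs
  rw [Measure.bind_apply hs hm.aemeasurable, Measure.map_apply hg hs,
    Measure.compProd_apply (hg hs)]
  refine lintegral_congr fun x => ?_
  exact Measure.map_apply (hg.comp measurable_prodMk_left) hs

theorem integrable_compProd_of_bounded {Y : Type*} [MeasurableSpace Y] (μ : Measure X)
    [IsProbabilityMeasure μ] (K : Kernel X Y) [IsMarkovKernel K] {h : X → Y → ℝ}
    (hm : Measurable fun p : X × Y => h p.1 p.2) {c : ℝ} (hc : ∀ x y, |h x y| ≤ c) :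
    Integrable (fun p : X × Y => h p.1 p.2) (μ ⊗ₘ K) :=
  Integrable.of_bound hm.aestronglyMeasurable c (ae_of_all _ fun p => hc p.1 p.2)

theorem abs_min_one_mul_le {a b c : ℝ} (ha : 0 ≤ a) (hb : |b| ≤ c) : |min 1 a * b| ≤ c := by
  have h0 : 0 ≤ min 1 a := le_min zero_le_one ha
  rw [abs_mul, abs_of_nonneg h0]
  calc min 1 a * |b| ≤ 1 * |b| := by gcongr; exact min_le_left _ _
    _ ≤ c := by rwa [one_mul]

theorem mul_min_one_inv {a : ℝ} (ha : 0 ≤ a) : a * min 1 a⁻¹ = min 1 a := by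
  rcases ha.eq_or_lt with rfl | ha
  · simp
  · rw [mul_min_of_nonneg _ _ ha.le, mul_inv_cancel₀ ha.ne', mul_one, min_comm]

theorem integral_accept_eq_of_withDensity (μ : Measure X) [IsProbabilityMeasure μ]
    (K₁ K₂ : Kernel X (X × V)) [IsMarkovKernel K₁] [IsMarkovKernel K₂] {a : X → X → V → ℝ}
    (ha : Measurable fun p : X × X × V => a p.1 p.2.1 p.2.2) (ha0 : ∀ x y v, 0 ≤ a x y v)
    (h : (μ.bind fun y => (K₂ y).map fun t => (t.1, y, t.2))
      = (μ.bind fun x => (K₁ x).map fun t => (x, t.1, t.2)).withDensity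
          fun p => ENNReal.ofReal (a p.1 p.2.1 p.2.2))
    {φ : X → X → ℝ} (hφ : Measurable fun p : X × X => φ p.1 p.2) {c : ℝ}
    (hc : ∀ x y, |φ x y| ≤ c) :
    ∫ x, ∫ t, min 1 (a x t.1 t.2) * φ x t.1 ∂(K₁ x) ∂μ
      = ∫ y, ∫ t, min 1 (a t.1 y t.2)⁻¹ * φ t.1 y ∂(K₂ y) ∂μ := by
  have h₁ : Measurable fun p : X × X × V => (p.1, p.2.1, p.2.2) := by fun_prop
  have h₂ : Measurable fun p : X × X × V => (p.2.1, p.1, p.2.2) := by fun_prop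
  have hφ' : Measurable fun p : X × X × V => φ p.1 p.2.1 :=
    hφ.comp (measurable_fst.prodMk (measurable_fst.comp measurable_snd))
  have hm₁ : Measurable fun p : X × X × V => min 1 (a p.1 p.2.1 p.2.2) * φ p.1 p.2.1 :=
    (measurable_const.min ha).mul hφ'
  have hm₂ : Measurable fun p : X × X × V => min 1 (a p.1 p.2.1 p.2.2)⁻¹ * φ p.1 p.2.1 :=
    (measurable_const.min ha.inv).mul hφ'
  rw [bind_map_eq_map_compProd μ K₂ (g := fun y t => (t.1, y, t.2)) h₂,
    bind_map_eq_map_compProd μ K₁ (g := fun x t => (x, t.1, t.2)) h₁] at h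
  rw [← Measure.integral_compProd (integrable_compProd_of_bounded μ K₁
      (h := fun x t => min 1 (a x t.1 t.2) * φ x t.1) hm₁
      fun x t => abs_min_one_mul_le (ha0 _ _ _) (hc _ _)),
    ← Measure.integral_compProd (integrable_compProd_of_bounded μ K₂
      (h := fun y t => min 1 (a t.1 y t.2)⁻¹ * φ t.1 y) (hm₂.comp h₂)
      fun x t => abs_min_one_mul_le (inv_nonneg.2 (ha0 _ _ _)) (hc _ _))]
  have e₂ := integral_map (μ := μ ⊗ₘ K₂) h₂.aemeasurable hm₂.aestronglyMeasurable
  have e₁ := integral_map (μ := μ ⊗ₘ K₁) h₁.aemeasurable hm₁.aestronglyMeasurable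
  refine e₁.symm.trans (Eq.trans ?_ e₂)
  rw [h, integral_withDensity_eq_integral_toReal_smul ha.ennreal_ofReal
    (ae_of_all _ fun _ => ENNReal.ofReal_lt_top)]
  refine integral_congr_ae (ae_of_all _ fun p => ?_)
  simp only [ENNReal.toReal_ofReal (ha0 _ _ _), smul_eq_mul, ← mul_assoc,
    mul_min_one_inv (ha0 _ _ _)]

theorem integral_add_congr_of_integral_eq {μ : Measure X} {f g r : X → ℝ} (hf : Integrable f μ)
    (hg : Integrable g μ) (h : ∫ x, f x ∂μ = ∫ x, g x ∂μ) :
    ∫ x, (f x + r x) ∂μ = ∫ x, (g x + r x) ∂μ := by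
  by_cases hr : Integrable r μ
  · rw [integral_add hf hr, integral_add hg hr, h]
  · rw [integral_undef, integral_undef]
    · exact fun H => hr ((integrable_add_iff_integrable_right hg).1 H)
    · exact fun H => hr ((integrable_add_iff_integrable_right hf).1 H)

theorem detailed_balance_of_withDensity (μ : Measure X) [IsProbabilityMeasure μ]
    (K₁ K₂ : Kernel X (X × V)) [IsMarkovKernel K₁] [IsMarkovKernel K₂] {a : X → X → V → ℝ}
    (ha : Measurable fun p : X × X × V => a p.1 p.2.1 p.2.2) (ha0 : ∀ x y v, 0 ≤ a x y v)
    (h : (μ.bind fun y => (K₂ y).map fun t => (t.1, y, t.2))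
      = (μ.bind fun x => (K₁ x).map fun t => (x, t.1, t.2)).withDensity
          fun p => ENNReal.ofReal (a p.1 p.2.1 p.2.2))
    {φ : X → X → ℝ} (hφ : Measurable fun p : X × X => φ p.1 p.2) {c : ℝ}
    (hc : ∀ x y, |φ x y| ≤ c) (r₁ r₂ : X → ℝ) :
    ∫ x, ((1 / 2) * ((∫ t, min 1 (a x t.1 t.2) * φ x t.1 ∂(K₁ x)) + r₁ x)
        + (1 / 2) * ((∫ t, min 1 (a t.1 x t.2)⁻¹ * φ x t.1 ∂(K₂ x)) + r₂ x)) ∂μ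
      = ∫ x, ((1 / 2) * ((∫ t, min 1 (a x t.1 t.2) * φ t.1 x ∂(K₁ x)) + r₁ x)
        + (1 / 2) * ((∫ t, min 1 (a t.1 x t.2)⁻¹ * φ t.1 x ∂(K₂ x)) + r₂ x)) ∂μ := by
  have hswap : Measurable fun p : X × X => φ p.2 p.1 := hφ.comp measurable_swap
  have int₁ {ψ : X → X → ℝ} (hψ : Measurable fun p : X × X => ψ p.1 p.2)
      (hb : ∀ x y, |ψ x y| ≤ c) :
      Integrable (fun x => ∫ t, min 1 (a x t.1 t.2) * ψ x t.1 ∂(K₁ x)) μ := by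
    refine Integrable.integral_compProd (integrable_compProd_of_bounded μ K₁
      (h := fun x t => min 1 (a x t.1 t.2) * ψ x t.1) ?_
      fun x t => abs_min_one_mul_le (ha0 _ _ _) (hb _ _))
    exact (measurable_const.min ha).mul
      (hψ.comp (measurable_fst.prodMk (measurable_fst.comp measurable_snd)))
  have int₂ {ψ : X → X → ℝ} (hψ : Measurable fun p : X × X => ψ p.1 p.2)
      (hb : ∀ x y, |ψ x y| ≤ c) :
      Integrable (fun x => ∫ t, min 1 (a t.1 x t.2)⁻¹ * ψ x t.1 ∂(K₂ x)) μ := by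
    have h₂ : Measurable fun p : X × X × V => (p.2.1, p.1, p.2.2) := by fun_prop
    refine Integrable.integral_compProd (integrable_compProd_of_bounded μ K₂
      (h := fun x t => min 1 (a t.1 x t.2)⁻¹ * ψ x t.1) ?_
      fun x t => abs_min_one_mul_le (inv_nonneg.2 (ha0 _ _ _)) (hb _ _))
    exact (measurable_const.min (ha.comp h₂).inv).mul
      (hψ.comp (measurable_fst.prodMk (measurable_fst.comp measurable_snd)))
  have e := integral_accept_eq_of_withDensity μ K₁ K₂ ha ha0 h hφ hc
  have e' := integral_accept_eq_of_withDensity μ K₁ K₂ ha ha0 h hswap fun x y => hc y x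
  have key := integral_add_congr_of_integral_eq (μ := μ)
    (r := fun x => (1 / 2) * r₁ x + (1 / 2) * r₂ x)
    (((int₁ hφ hc).const_mul (1 / 2)).add ((int₂ hφ hc).const_mul (1 / 2)))
    (((int₁ hswap fun x y => hc y x).const_mul (1 / 2)).add
      ((int₂ hswap fun x y => hc y x).const_mul (1 / 2))) (by
    simp only [Pi.add_apply]
    rw [integral_add ((int₁ hφ hc).const_mul _) ((int₂ hφ hc).const_mul _),
      integral_add ((int₁ hswap fun x y => hc y x).const_mul _)
        ((int₂ hswap fun x y => hc y x).const_mul _)]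
    simp only [integral_const_mul]
    rw [e, e', add_comm])
  simp only [Pi.add_apply] at key
  convert key using 3 <;> ring

end DetailedBalance

section Proposals

variable {Θ Z U ι : Type*} [MeasurableSpace Θ] [MeasurableSpace Z] [MeasurableSpace U]
  [Fintype ι] [MeasurableSpace ι]

/-- The proposal which draws a parameter `θ'`, an i.i.d. family of paths, an index with
weights `w`, and finally a latent variable from the endpoint `e` of the selected path. -/
noncomputable def forwardProposal (q : Kernel Θ Θ) (Q : Kernel (Θ × Θ × Z) U)
    (R : Kernel (Θ × Z) Z) (e : U → Z) (w : Θ → Θ → (ι → U) → ι → ℝ≥0∞) (x : Θ × Z) :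
    Measure ((Θ × Z) × (ι → U) × ι) :=
  (q x.1).bind fun θ' => (Measure.pi fun _ : ι => Q (x.1, θ', x.2)).bind fun us =>
    ∑ k : ι, w x.1 θ' us k • (R (θ', e (us k))).map fun z' => ((θ', z'), us, k)

/-- The proposal which draws a parameter `θ'`, a `k`-th path transformed by `rev`, a latent
variable from its endpoint `e`, and the other paths conditionally on the new state; each index
has weight `c`. -/
noncomputable def backwardProposal [DecidableEq ι] (q : Kernel Θ Θ) (Q : Kernel (Θ × Θ × Z) U)
    (R : Kernel (Θ × Z) Z) (rev : U → U) (e : U → Z) (c : ℝ≥0∞) (x : Θ × Z) :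
    Measure ((Θ × Z) × (ι → U) × ι) :=
  (q x.1).bind fun θ' => ∑ k : ι, c • (((Q (x.1, θ', x.2)).map rev).bind fun u =>
    (R (θ', e u)).bind fun z' =>
      (Measure.pi fun i : ι => if i = k then Measure.dirac u else Q (θ', x.1, z')).map
        fun us => ((θ', z'), us, k))

variable {q : Kernel Θ Θ} {Q : Kernel (Θ × Θ × Z) U} [IsMarkovKernel Q]
  {R : Kernel (Θ × Z) Z} [IsMarkovKernel R]

section Forward

variable {e : U → Z} {w : Θ → Θ → (ι → U) → ι → ℝ≥0∞}

theorem measurable_forward_step (he : Measurable e)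
    (hw : ∀ k, Measurable fun p : Θ × Θ × (ι → U) => w p.1 p.2.1 p.2.2 k) :
    Measurable fun p : ((Θ × Z) × Θ) × (ι → U) =>
      ∑ k : ι, w p.1.1.1 p.1.2 p.2 k • (R (p.1.2, e (p.2 k))).map
        fun z' => ((p.1.2, z'), p.2, k) := by
  refine measurable_finset_sum_measure _ fun k _ => measurable_smul_measure_family ?_ ?_
  · refine measurable_map_family ?_ (fun _ => inferInstance) ?_
    · exact R.measurable.comp (by fun_prop)
    · fun_prop
  · exact (hw k).comp (f := fun p : ((Θ × Z) × Θ) × (ι → U) => (p.1.1.1, p.1.2, p.2))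
      (by fun_prop)

theorem measurable_forward_paths (he : Measurable e)
    (hw : ∀ k, Measurable fun p : Θ × Θ × (ι → U) => w p.1 p.2.1 p.2.2 k) :
    Measurable fun p : (Θ × Z) × Θ =>
      (Measure.pi fun _ : ι => Q (p.1.1, p.2, p.1.2)).bind fun us =>
        ∑ k : ι, w p.1.1 p.2 us k • (R (p.2, e (us k))).map
          fun z' => ((p.2, z'), us, k) :=
  measurable_bind_family (measurable_pi_kernel_comp (by fun_prop)) (fun _ => inferInstance)
    (measurable_forward_step he hw)

theorem measurable_forwardProposal [IsMarkovKernel q] (he : Measurable e)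
    (hw : ∀ k, Measurable fun p : Θ × Θ × (ι → U) => w p.1 p.2.1 p.2.2 k) :
    Measurable (forwardProposal q Q R e w) :=
  measurable_bind_family (κ := fun x : Θ × Z => q x.1)
    (q.measurable.comp measurable_fst) (fun _ => inferInstance)
    (measurable_forward_paths he hw)

theorem lintegral_forwardProposal (he : Measurable e)
    (hw : ∀ k, Measurable fun p : Θ × Θ × (ι → U) => w p.1 p.2.1 p.2.2 k)
    {f : (Θ × Z) × (ι → U) × ι → ℝ≥0∞} (hf : Measurable f) (x : Θ × Z) :
    ∫⁻ t, f t ∂(forwardProposal q Q R e w x)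
      = ∫⁻ θ', ∫⁻ us, ∑ k, w x.1 θ' us k * ∫⁻ z', f ((θ', z'), us, k) ∂(R (θ', e (us k)))
          ∂(Measure.pi fun _ : ι => Q (x.1, θ', x.2)) ∂(q x.1) := by
  rw [forwardProposal]
  refine (lintegral_bind_of_measurable ?_ hf).trans (lintegral_congr fun θ' => ?_)
  · have h := (measurable_forward_paths (Q := Q) (R := R) he hw).comp
      (measurable_prodMk_left (x := x))
    exact h
  refine (lintegral_bind_of_measurable ?_ hf).trans (lintegral_congr fun us => ?_)
  · have h := (measurable_forward_step (R := R) he hw).comp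
      (measurable_prodMk_left (x := (x, θ')))
    exact h
  rw [lintegral_finsetSum_measure]
  refine Finset.sum_congr rfl fun k _ => ?_
  rw [lintegral_smul_measure, lintegral_map hf (by fun_prop), smul_eq_mul]

theorem isProbabilityMeasure_forwardProposal [IsMarkovKernel q] (he : Measurable e)
    (hw : ∀ k, Measurable fun p : Θ × Θ × (ι → U) => w p.1 p.2.1 p.2.2 k)
    (hw1 : ∀ a b us, ∑ k, w a b us k = 1) (x : Θ × Z) :
    IsProbabilityMeasure (forwardProposal q Q R e w x) := by
  constructor
  rw [← lintegral_one, lintegral_forwardProposal he hw measurable_const]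
  simp [hw1]

end Forward

section Backward

variable [DecidableEq ι] {rev : U → U} {e : U → Z} {c : ℝ≥0∞}

theorem measurable_backward_paths (k : ι) :
    Measurable fun p : (((Θ × Z) × Θ) × U) × Z =>
      (Measure.pi fun i : ι => if i = k then Measure.dirac p.1.2
          else Q (p.1.1.2, p.1.1.1.1, p.2)).map
        fun us => ((p.1.1.2, p.2), us, k) :=
  measurable_map_family (measurable_pi_ite_dirac_kernel_comp (by fun_prop) (by fun_prop) k)
    (fun _ => isProbabilityMeasure_pi_ite_dirac _ _ _) (by fun_prop)

theorem measurable_backward_latent (he : Measurable e) (k : ι) :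
    Measurable fun p : ((Θ × Z) × Θ) × U => (R (p.1.2, e p.2)).bind fun z' =>
      (Measure.pi fun i : ι => if i = k then Measure.dirac p.2
          else Q (p.1.2, p.1.1.1, z')).map
        fun us => ((p.1.2, z'), us, k) :=
  measurable_bind_family (κ := fun p : ((Θ × Z) × Θ) × U => R (p.1.2, e p.2))
    (R.measurable.comp (by fun_prop)) (fun _ => inferInstance) (measurable_backward_paths k)

theorem measurable_backward_step (hrev : Measurable rev) (he : Measurable e) :
    Measurable fun p : (Θ × Z) × Θ =>
      ∑ k : ι, c • (((Q (p.1.1, p.2, p.1.2)).map rev).bind fun u =>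
        (R (p.2, e u)).bind fun z' =>
          (Measure.pi fun i : ι => if i = k then Measure.dirac u else Q (p.2, p.1.1, z')).map
            fun us => ((p.2, z'), us, k)) :=
  measurable_finset_sum_measure _ fun k _ => measurable_smul_measure_family
    (measurable_bind_family (κ := fun p : (Θ × Z) × Θ => (Q (p.1.1, p.2, p.1.2)).map rev)
      ((Measure.measurable_map _ hrev).comp (Q.measurable.comp (by fun_prop)))
      (fun _ => Measure.isProbabilityMeasure_map hrev.aemeasurable)
      (measurable_backward_latent he k)) measurable_const

theorem measurable_backwardProposal [IsMarkovKernel q] (hrev : Measurable rev) (he : Measurable e) :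
    Measurable (backwardProposal (ι := ι) q Q R rev e c) :=
  measurable_bind_family (κ := fun x : Θ × Z => q x.1)
    (q.measurable.comp measurable_fst) (fun _ => inferInstance)
    (measurable_backward_step hrev he)

theorem lintegral_backwardProposal (hrev : Measurable rev) (he : Measurable e)
    {f : (Θ × Z) × (ι → U) × ι → ℝ≥0∞} (hf : Measurable f) (x : Θ × Z) :
    ∫⁻ t, f t ∂(backwardProposal q Q R rev e c x)
      = ∫⁻ θ', ∑ k, c * ∫⁻ u, ∫⁻ z', ∫⁻ us, f ((θ', z'), us, k)
            ∂(Measure.pi fun i : ι =>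
              if i = k then Measure.dirac (rev u) else Q (θ', x.1, z'))
          ∂(R (θ', e (rev u))) ∂(Q (x.1, θ', x.2)) ∂(q x.1) := by
  rw [backwardProposal]
  refine (lintegral_bind_of_measurable ?_ hf).trans (lintegral_congr fun θ' => ?_)
  · have h := (measurable_backward_step (ι := ι) (Q := Q) (R := R) (c := c) hrev he).comp
      (measurable_prodMk_left (x := x))
    exact h
  rw [lintegral_finsetSum_measure]
  refine Finset.sum_congr rfl fun k _ => ?_
  have hlat : Measurable fun u => (R (θ', e u)).bind fun z' =>
      (Measure.pi fun i : ι => if i = k then Measure.dirac u else Q (θ', x.1, z')).map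
        fun us => ((θ', z'), us, k) := by
    have h := (measurable_backward_latent (Q := Q) (R := R) he k).comp
      (measurable_prodMk_left (x := (x, θ')))
    exact h
  have hlin := (Measure.measurable_lintegral hf).comp hlat
  simp only [Function.comp_def] at hlin
  rw [lintegral_smul_measure, smul_eq_mul, lintegral_bind_of_measurable hlat hf,
    lintegral_map hlin hrev]
  congr 1
  refine lintegral_congr fun u => ?_
  refine (lintegral_bind_of_measurable ?_ hf).trans (lintegral_congr fun z' => ?_)
  · have h := (measurable_backward_paths (Q := Q) k).comp
      (measurable_prodMk_left (x := ((x, θ'), rev u)))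
    exact h
  rw [lintegral_map hf (by fun_prop)]

theorem isProbabilityMeasure_backwardProposal [IsMarkovKernel q] (hrev : Measurable rev)
    (he : Measurable e) (hc : Fintype.card ι * c = 1) (x : Θ × Z) :
    IsProbabilityMeasure (backwardProposal (ι := ι) q Q R rev e c x) := by
  have := fun (k : ι) (u : U) (y : Θ × Θ × Z) => isProbabilityMeasure_pi_ite_dirac (Q y) k u
  constructor
  rw [← lintegral_one, lintegral_backwardProposal hrev he measurable_const]
  simp [hc]

end Backward

section Joint

variable {μ : Measure Θ} {κ : Kernel Θ Z} [IsMarkovKernel κ]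

theorem lintegral_bind_map_prodMk {f : Θ × Z → ℝ≥0∞} (hf : Measurable f) :
    ∫⁻ x, f x ∂(μ.bind fun θ => (κ θ).map fun z => (θ, z))
      = ∫⁻ θ, ∫⁻ z, f (θ, z) ∂(κ θ) ∂μ := by
  rw [lintegral_bind_of_measurable
    (measurable_map_family κ.measurable (fun _ => inferInstance) (by fun_prop)) hf]
  refine lintegral_congr fun θ => ?_
  rw [lintegral_map hf (by fun_prop)]

theorem lintegral_joint_law [IsMarkovKernel q] {W : Type*} [MeasurableSpace W]
    {η : Θ × Θ × Z → Measure U} (hη : Measurable η) (hp : ∀ y, IsProbabilityMeasure (η y))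
    {e : U → Z} (he : Measurable e) {g : Θ → Z → Θ → U → Z → W}
    (hg : Measurable fun p : (((Θ × Z) × Θ) × U) × Z =>
      g p.1.1.1.1 p.1.1.1.2 p.1.1.2 p.1.2 p.2)
    {f : W → ℝ≥0∞} (hf : Measurable f) :
    ∫⁻ y, f y ∂(μ.bind fun θ => (κ θ).bind fun z => (q θ).bind fun θ' =>
        (η (θ, θ', z)).bind fun u => (R (θ', e u)).map fun z' => g θ z θ' u z')
      = ∫⁻ θ, ∫⁻ z, ∫⁻ θ', ∫⁻ u, ∫⁻ z', f (g θ z θ' u z') ∂(R (θ', e u))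
          ∂(η (θ, θ', z)) ∂(q θ) ∂(κ θ) ∂μ := by
  have h₁ : Measurable fun p : ((Θ × Z) × Θ) × U =>
      (R (p.1.2, e p.2)).map fun z' => g p.1.1.1 p.1.1.2 p.1.2 p.2 z' :=
    measurable_map_family (κ := fun p : ((Θ × Z) × Θ) × U => R (p.1.2, e p.2))
      (R.measurable.comp (by fun_prop)) (fun _ => inferInstance) hg
  have h₂ : Measurable fun p : (Θ × Z) × Θ => (η (p.1.1, p.2, p.1.2)).bind fun u =>
      (R (p.2, e u)).map fun z' => g p.1.1 p.1.2 p.2 u z' :=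
    measurable_bind_family (κ := fun p : (Θ × Z) × Θ => η (p.1.1, p.2, p.1.2))
      (hη.comp (by fun_prop)) (fun _ => hp _) h₁
  have h₃ : Measurable fun p : Θ × Z => (q p.1).bind fun θ' =>
      (η (p.1, θ', p.2)).bind fun u => (R (θ', e u)).map fun z' => g p.1 p.2 θ' u z' :=
    measurable_bind_family (κ := fun p : Θ × Z => q p.1)
      (q.measurable.comp (by fun_prop)) (fun _ => inferInstance) h₂
  have h₄ : Measurable fun θ => (κ θ).bind fun z => (q θ).bind fun θ' =>
      (η (θ, θ', z)).bind fun u => (R (θ', e u)).map fun z' => g θ z θ' u z' :=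
    measurable_bind_family κ.measurable (fun _ => inferInstance) h₃
  refine (lintegral_bind_of_measurable h₄ hf).trans (lintegral_congr fun θ => ?_)
  have h₃' := h₃.comp (measurable_prodMk_left (x := θ))
  refine (lintegral_bind_of_measurable h₃' hf).trans (lintegral_congr fun z => ?_)
  have h₂' := h₂.comp (measurable_prodMk_left (x := (θ, z)))
  refine (lintegral_bind_of_measurable h₂' hf).trans (lintegral_congr fun θ' => ?_)
  have h₁' := h₁.comp (measurable_prodMk_left (x := ((θ, z), θ')))
  refine (lintegral_bind_of_measurable h₁' hf).trans (lintegral_congr fun u => ?_)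
  have hg' := hg.comp (measurable_prodMk_left (x := (((θ, z), θ'), u)))
  exact lintegral_map hf hg'

theorem lintegral_bind_map_family {X Y W : Type*} [MeasurableSpace X] [MeasurableSpace Y]
    [MeasurableSpace W] {ν : Measure X} {K : X → Measure Y} (hK : Measurable K)
    (hp : ∀ x, IsProbabilityMeasure (K x)) {g : X → Y → W}
    (hg : Measurable fun p : X × Y => g p.1 p.2) {f : W → ℝ≥0∞} (hf : Measurable f) :
    ∫⁻ y, f y ∂(ν.bind fun x => (K x).map (g x)) = ∫⁻ x, ∫⁻ t, f (g x t) ∂(K x) ∂ν := by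
  rw [lintegral_bind_of_measurable (measurable_map_family hK hp hg) hf]
  refine lintegral_congr fun x => ?_
  have hgx := hg.comp (measurable_prodMk_left (x := x))
  exact lintegral_map hf hgx

theorem backward_eq_withDensity_forward [IsMarkovKernel q] [DecidableEq ι] {rev : U → U}
    (hrev : Measurable rev) {e₀ e₁ : U → Z} (he₀ : Measurable e₀) (he₁ : Measurable e₁)
    {r : Θ → Θ → U → ℝ≥0∞} (hr : Measurable fun p : Θ × Θ × U => r p.1 p.2.1 p.2.2)
    (hkey : (μ.bind fun θ' => (κ θ').bind fun z' => (q θ').bind fun θ =>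
        ((Q (θ', θ, z')).map rev).bind fun u =>
          (R (θ, e₀ u)).map fun z => (θ, z, u, θ', z'))
      = (μ.bind fun θ => (κ θ).bind fun z => (q θ).bind fun θ' =>
          (Q (θ, θ', z)).bind fun u =>
            (R (θ', e₁ u)).map fun z' => (θ, z, u, θ', z')).withDensity
          fun p : Θ × Z × U × Θ × Z => r p.1 p.2.2.2.1 p.2.2.1)
    {w : Θ → Θ → (ι → U) → ι → ℝ≥0∞}
    (hw : ∀ k, Measurable fun p : Θ × Θ × (ι → U) => w p.1 p.2.1 p.2.2 k)
    {d : Θ → Θ → (ι → U) → ℝ≥0∞}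
    (hd : Measurable fun p : Θ × Θ × (ι → U) => d p.1 p.2.1 p.2.2) {c : ℝ≥0∞}
    (hwd : ∀ a b us k, w a b us k * d a b us = r a b (us k) * c)
    (hw1 : ∀ a b us, ∑ k, w a b us k = 1) (hc : Fintype.card ι * c = 1) :
    ((μ.bind fun θ => (κ θ).map fun z => (θ, z)).bind fun y =>
        (backwardProposal q Q R rev e₀ c y).map fun t => (t.1, y, t.2.1, t.2.2))
      = ((μ.bind fun θ => (κ θ).map fun z => (θ, z)).bind fun x =>
          (forwardProposal q Q R e₁ w x).map fun t => (x, t.1, t.2.1, t.2.2)).withDensity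
          fun p : (Θ × Z) × (Θ × Z) × (ι → U) × ι => d p.1.1 p.2.1.1 p.2.2.1 := by
  have hpi := fun (k : ι) (u : U) (y : Θ × Θ × Z) => isProbabilityMeasure_pi_ite_dirac (Q y) k u
  have hB := isProbabilityMeasure_backwardProposal (ι := ι) (q := q) (Q := Q) (R := R) hrev he₀ hc
  have hF := isProbabilityMeasure_forwardProposal (q := q) (Q := Q) (R := R) he₁ hw hw1
  have hBm : Measurable (backwardProposal (ι := ι) q Q R rev e₀ c) :=
    measurable_backwardProposal hrev he₀
  have hFm : Measurable (forwardProposal q Q R e₁ w) := measurable_forwardProposal he₁ hw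
  have hd' : Measurable fun p : (Θ × Z) × (Θ × Z) × (ι → U) × ι => d p.1.1 p.2.1.1 p.2.2.1 :=
    hd.comp (f := fun p : (Θ × Z) × (Θ × Z) × (ι → U) × ι => (p.1.1, p.2.1.1, p.2.2.1))
      (by fun_prop)
  have hr' : Measurable fun p : Θ × Z × U × Θ × Z => r p.1 p.2.2.2.1 p.2.2.1 :=
    hr.comp (f := fun p : Θ × Z × U × Θ × Z => (p.1, p.2.2.2.1, p.2.2.1)) (by fun_prop)
  refine Measure.ext_of_lintegral _ fun f hf => ?_
  have hfk (k : ι) : Measurable fun p : (Θ × Z × U × Θ × Z) × (ι → U) =>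
      f ((p.1.1, p.1.2.1), (p.1.2.2.2.1, p.1.2.2.2.2), p.2, k) := hf.comp (by fun_prop)
  have hGk (k : ι) : Measurable fun p : Θ × Z × U × Θ × Z =>
      ∫⁻ us, f ((p.1, p.2.1), (p.2.2.2.1, p.2.2.2.2), us, k)
        ∂(Measure.pi fun i : ι =>
          if i = k then Measure.dirac p.2.2.1 else Q (p.1, p.2.2.2.1, p.2.1)) :=
    measurable_lintegral_family (measurable_pi_ite_dirac_kernel_comp (by fun_prop)
      (by fun_prop) k) (fun _ => hpi _ _ _) (hfk k)
  have hG : Measurable fun p : Θ × Z × U × Θ × Z =>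
      ∑ k, c * ∫⁻ us, f ((p.1, p.2.1), (p.2.2.2.1, p.2.2.2.2), us, k)
        ∂(Measure.pi fun i : ι =>
          if i = k then Measure.dirac p.2.2.1 else Q (p.1, p.2.2.2.1, p.2.1)) :=
    Finset.measurable_sum _ fun k _ => (hGk k).const_mul c
  have hBf : Measurable fun p : (Θ × Z) × (Θ × Z) × (ι → U) × ι =>
      f (p.2.1, p.1, p.2.2.1, p.2.2.2) := hf.comp (by fun_prop)
  rw [lintegral_bind_map_family hBm hB (g := fun y t => (t.1, y, t.2.1, t.2.2)) (by fun_prop) hf,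
    lintegral_bind_map_prodMk (measurable_lintegral_family hBm hB hBf),
    lintegral_withDensity_eq_lintegral_mul _ hd' hf,
    lintegral_bind_map_family hFm hF (g := fun x t => (x, t.1, t.2.1, t.2.2)) (by fun_prop)
      (hd'.mul hf),
    lintegral_bind_map_prodMk (measurable_lintegral_family hFm hF (hd'.mul hf))]
  have key := congrArg (fun m => ∫⁻ p, (fun p : Θ × Z × U × Θ × Z =>
      ∑ k, c * ∫⁻ us, f ((p.1, p.2.1), (p.2.2.2.1, p.2.2.2.2), us, k)
        ∂(Measure.pi fun i : ι =>
          if i = k then Measure.dirac p.2.2.1 else Q (p.1, p.2.2.2.1, p.2.1))) p ∂m) hkey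
  simp only at key
  rw [lintegral_joint_law (η := fun y => (Q y).map rev)
      ((Measure.measurable_map _ hrev).comp Q.measurable)
      (fun _ => Measure.isProbabilityMeasure_map hrev.aemeasurable) he₀
      (g := fun θ' z' θ u z => (θ, z, u, θ', z')) (by fun_prop) hG,
    lintegral_withDensity_eq_lintegral_mul _ hr' hG,
    lintegral_joint_law Q.measurable (fun _ => inferInstance) he₁
      (g := fun θ z θ' u z' => (θ, z, u, θ', z')) (by fun_prop) (hr'.mul hG)] at key
  refine Eq.trans ?_ (key.trans ?_)
  · refine lintegral_congr fun θ' => lintegral_congr fun z' => ?_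
    have hBf' := hBf.comp (measurable_prodMk_left (x := (θ', z')))
    refine (lintegral_backwardProposal hrev he₀ hBf' (θ', z')).trans
      (lintegral_congr fun θ => ?_)
    have hGθ (k : ι) : Measurable fun p : U × Z => ∫⁻ us, f ((θ, p.2), (θ', z'), us, k)
        ∂(Measure.pi fun i : ι => if i = k then Measure.dirac p.1 else Q (θ, θ', p.2)) :=
      (hGk k).comp (f := fun p : U × Z => (θ, p.2, p.1, θ', z')) (by fun_prop)
    have hz (k : ι) (u : U) : Measurable fun z => ∫⁻ us, f ((θ, z), (θ', z'), us, k)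
        ∂(Measure.pi fun i : ι => if i = k then Measure.dirac u else Q (θ, θ', z)) :=
      (hGθ k).comp (f := fun z => (u, z)) (by fun_prop)
    have hu (k : ι) : Measurable fun u => ∫⁻ z, ∫⁻ us, f ((θ, z), (θ', z'), us, k)
        ∂(Measure.pi fun i : ι => if i = k then Measure.dirac u else Q (θ, θ', z))
        ∂(R (θ, e₀ u)) :=
      measurable_lintegral_family (κ := fun u => R (θ, e₀ u)) (R.measurable.comp (by fun_prop))
        (fun _ => inferInstance) (hGθ k)
    have hsum (u : U) : ∫⁻ z, ∑ k, c * ∫⁻ us, f ((θ, z), (θ', z'), us, k)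
        ∂(Measure.pi fun i : ι => if i = k then Measure.dirac u else Q (θ, θ', z))
        ∂(R (θ, e₀ u)) = ∑ k, c * ∫⁻ z, ∫⁻ us, f ((θ, z), (θ', z'), us, k)
        ∂(Measure.pi fun i : ι => if i = k then Measure.dirac u else Q (θ, θ', z))
        ∂(R (θ, e₀ u)) := by
      rw [lintegral_finsetSum _ fun k _ => (hz k u).const_mul c]
      exact Finset.sum_congr rfl fun k _ => lintegral_const_mul c (hz k u)
    simp_rw [hsum]
    rw [lintegral_finsetSum _ fun k _ => (hu k).const_mul c]
    refine Finset.sum_congr rfl fun k _ => ?_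
    rw [lintegral_const_mul c (hu k), lintegral_map (hu k) hrev]
    simp only [Function.comp_apply]
  · refine lintegral_congr fun θ => lintegral_congr fun z => ?_
    have hFf := (hd'.mul hf).comp (measurable_prodMk_left (x := (θ, z)))
    refine Eq.trans (lintegral_congr fun θ' => ?_)
      (lintegral_forwardProposal he₁ hw hFf (θ, z)).symm
    have hfk' (k : ι) : Measurable fun p : Z × (ι → U) => f ((θ, z), (θ', p.1), p.2, k) :=
      hf.comp (by fun_prop)
    have hru : Measurable fun u => r θ θ' u := hr.comp (f := fun u => (θ, θ', u)) (by fun_prop)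
    have hGu (k : ι) : Measurable fun p : U × Z =>
        r θ θ' p.1 * (c * ∫⁻ us, f ((θ, z), (θ', p.2), us, k)
          ∂(Measure.pi fun i : ι => if i = k then Measure.dirac p.1 else Q (θ, θ', z))) := by
      refine (hru.comp measurable_fst).mul (Measurable.const_mul ?_ c)
      exact (hGk k).comp (f := fun p : U × Z => (θ, z, p.1, θ', p.2)) (by fun_prop)
    have hGz (k : ι) (u : U) : Measurable fun z' =>
        r θ θ' u * (c * ∫⁻ us, f ((θ, z), (θ', z'), us, k)
          ∂(Measure.pi fun i : ι => if i = k then Measure.dirac u else Q (θ, θ', z))) :=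
      (hGu k).comp (f := fun z' => (u, z')) (by fun_prop)
    have hR (k : ι) : Measurable fun us : ι → U => w θ θ' us k *
        ∫⁻ z', d θ θ' us * f ((θ, z), (θ', z'), us, k) ∂(R (θ', e₁ (us k))) := by
      refine ((hw k).comp (f := fun us : ι → U => (θ, θ', us)) (by fun_prop)).mul ?_
      refine measurable_lintegral_family (κ := fun us : ι → U => R (θ', e₁ (us k)))
        (R.measurable.comp (by fun_prop)) (fun _ => inferInstance) ?_
      exact (hd.comp (f := fun p : (ι → U) × Z => (θ, θ', p.1)) (by fun_prop)).mul
        (hf.comp (f := fun p : (ι → U) × Z => ((θ, z), (θ', p.2), p.1, k)) (by fun_prop))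
    simp only [Function.comp_apply, Pi.mul_apply, Finset.mul_sum]
    rw [lintegral_finsetSum _ fun k _ => hR k]
    have hsum (u : U) := lintegral_finsetSum (μ := R (θ', e₁ u)) Finset.univ fun k _ => hGz k u
    simp_rw [hsum]
    rw [lintegral_finsetSum _ fun k _ => measurable_lintegral_family
      (κ := fun u => R (θ', e₁ u)) (R.measurable.comp (by fun_prop)) (fun _ => inferInstance)
      (hGu k)]
    exact Finset.sum_congr rfl fun k _ => lintegral_resample _ (η := fun u => R (θ', e₁ u))
      (R.measurable.comp (by fun_prop)) (fun _ => inferInstance) hru (hfk' k) k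
      fun us => hwd θ θ' us k

end Joint

end Proposals

/-- **MHAAR for latent variable models (Proposition 3 /
`prop: asymmetric MCMC with latent variables` of Andrieu, Doucet, Yıldırım & Chopin).**

On `X = Θ × Z` with `π(d(θ,z)) = π_Θ(dθ) π_θ(dz)`, proposal `q` on `Θ`, AIS kernels
`Q_{θ,θ',z}` on `U = Z^{T+1}`, the order-reversing involution, kernels `R_θ` on `Z`, and a
measurable `ϱ : Θ × Θ × U → [0,∞)` with
`π_Θ(dθ')π_{θ'}(dz')q(θ',dθ)Q̄_{θ',θ,z'}(du)R_θ(u₀,dz)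
  = ϱ(θ,θ',u) ⬝ π_Θ(dθ)π_θ(dz)q(θ,dθ')Q_{θ,θ',z}(du)R_{θ'}(u_T,dz')`,
the proposals `Q₁^N, Q₂^N` of Algorithm 4 satisfy, with
`ϱ^N(θ,θ',us) = N⁻¹ ∑ᵢ ϱ(θ,θ',u⁽ⁱ⁾)`,
`π(dy) Q₂^N(y, d(x,us,k)) = ϱ^N(θ,θ',us) ⬝ π(dx) Q₁^N(x, d(y,us,k))` (coordinates
`(x,y,us,k)`, `x = (θ,z)`, `y = (θ',z')`), and consequently the MHAAR kernel which with
probability `1/2` proposes from `Q₁^N` accepting with probability `min{1, ϱ^N(θ,θ',us)}`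
and with probability `1/2` proposes from `Q₂^N` accepting with probability
`min{1, 1/ϱ^N(θ',θ,us)}` satisfies detailed balance with respect to `π`. -/
theorem mhaar_latent_variable
    {Θ Z : Type*} [MeasurableSpace Θ] [MeasurableSpace Z]
    (T : ℕ)
    (πΘ : Measure Θ) [IsProbabilityMeasure πΘ]
    (πZ : Kernel Θ Z) [IsMarkovKernel πZ]
    (q : Kernel Θ Θ) [IsMarkovKernel q]
    (Q : Kernel (Θ × Θ × Z) (Fin (T + 1) → Z)) [IsMarkovKernel Q]
    (R : Kernel (Θ × Z) Z) [IsMarkovKernel R]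
    (ϱ : Θ → Θ → (Fin (T + 1) → Z) → ℝ)
    (hϱm : Measurable (fun p : Θ × Θ × (Fin (T + 1) → Z) => ϱ p.1 p.2.1 p.2.2))
    (hϱ0 : ∀ a b u, 0 ≤ ϱ a b u)
    -- the asymmetric acceptance-ratio identity for a single auxiliary variable,
    -- coordinates `(θ, z, u, θ', z')`
    (hkey : πΘ.bind (fun θ' => (πZ θ').bind (fun z' => (q θ').bind (fun θ =>
        ((Q (θ', θ, z')).map (fun u (i : Fin (T + 1)) => u i.rev)).bind (fun u =>
          (R (θ, u 0)).map (fun z => (θ, z, u, θ', z'))))))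
      = (πΘ.bind (fun θ => (πZ θ).bind (fun z => (q θ).bind (fun θ' =>
          (Q (θ, θ', z)).bind (fun u =>
            (R (θ', u (Fin.last T))).map (fun z' => (θ, z, u, θ', z'))))))).withDensity
          (fun p : Θ × Z × (Fin (T + 1) → Z) × Θ × Z =>
            ENNReal.ofReal (ϱ p.1 p.2.2.2.1 p.2.2.1)))
    (N : ℕ) (hN : 1 ≤ N)
    (w : Θ → Θ → (Fin N → Fin (T + 1) → Z) → Fin N → ℝ)
    (hw : ∀ a b us k, w a b us k =
      if 0 < ∑ i, ϱ a b (us i) then ϱ a b (us k) / ∑ i, ϱ a b (us i) else (N : ℝ)⁻¹)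
    (ϱN : Θ → Θ → (Fin N → Fin (T + 1) → Z) → ℝ)
    (hϱN : ∀ a b us, ϱN a b us = (N : ℝ)⁻¹ * ∑ i, ϱ a b (us i))
    (Q1N Q2N : Θ × Z → Measure ((Θ × Z) × (Fin N → Fin (T + 1) → Z) × Fin N))
    (hQ1N : ∀ x : Θ × Z, Q1N x = (q x.1).bind (fun θ' =>
      (Measure.pi (fun _ : Fin N => Q (x.1, θ', x.2))).bind (fun us =>
        ∑ k : Fin N, ENNReal.ofReal (w x.1 θ' us k) •
          ((R (θ', us k (Fin.last T))).map (fun z' => ((θ', z'), us, k))))))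
    (hQ2N : ∀ x : Θ × Z, Q2N x = (q x.1).bind (fun θ' =>
      ∑ k : Fin N, ((N : ℝ≥0∞))⁻¹ •
        (((Q (x.1, θ', x.2)).map (fun u (i : Fin (T + 1)) => u i.rev)).bind (fun uk =>
          (R (θ', uk 0)).bind (fun z' =>
            (Measure.pi (fun i : Fin N =>
                if i = k then Measure.dirac uk else Q (θ', x.1, z'))).map
              (fun us => ((θ', z'), us, k)))))))
    (ρ1 ρ2 : Θ × Z → ℝ)
    (hρ1 : ∀ x, ρ1 x = 1 - ∫ t, min 1 (ϱN x.1 t.1.1 t.2.1) ∂(Q1N x))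
    (hρ2 : ∀ x, ρ2 x = 1 - ∫ t, min 1 (ϱN t.1.1 x.1 t.2.1)⁻¹ ∂(Q2N x)) :
    -- (i) the averaged asymmetric acceptance-ratio identity, coordinates `(x, y, us, k)`
    ((πΘ.bind (fun θ => (πZ θ).map (fun z => (θ, z)))).bind (fun y =>
        (Q2N y).map (fun t => (t.1, y, t.2.1, t.2.2)))
      = ((πΘ.bind (fun θ => (πZ θ).map (fun z => (θ, z)))).bind (fun x =>
          (Q1N x).map (fun t => (x, t.1, t.2.1, t.2.2)))).withDensity
          (fun p : (Θ × Z) × (Θ × Z) × (Fin N → Fin (T + 1) → Z) × Fin N =>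
            ENNReal.ofReal (ϱN p.1.1 p.2.1.1 p.2.2.1)))
    -- (ii) detailed balance of the resulting MHAAR kernel with respect to `π`
    ∧ (∀ φ : Θ × Z → Θ × Z → ℝ,
        Measurable (Function.uncurry φ) → (∃ c, ∀ x y, |φ x y| ≤ c) →
        ∫ x, ((1/2) * ((∫ t, min 1 (ϱN x.1 t.1.1 t.2.1) * φ x t.1 ∂(Q1N x))
              + ρ1 x * φ x x)
            + (1/2) * ((∫ t, min 1 (ϱN t.1.1 x.1 t.2.1)⁻¹ * φ x t.1 ∂(Q2N x))
              + ρ2 x * φ x x))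
          ∂(πΘ.bind (fun θ => (πZ θ).map (fun z => (θ, z))))
        = ∫ x, ((1/2) * ((∫ t, min 1 (ϱN x.1 t.1.1 t.2.1) * φ t.1 x ∂(Q1N x))
              + ρ1 x * φ x x)
            + (1/2) * ((∫ t, min 1 (ϱN t.1.1 x.1 t.2.1)⁻¹ * φ t.1 x ∂(Q2N x))
              + ρ2 x * φ x x))
          ∂(πΘ.bind (fun θ => (πZ θ).map (fun z => (θ, z))))) := by
  have hϱN0 (a b us) : 0 ≤ ϱN a b us := by
    rw [hϱN]
    exact mul_nonneg (by positivity) (Finset.sum_nonneg fun i _ => hϱ0 _ _ _)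
  have hϱi (i : Fin N) :
      Measurable fun p : Θ × Θ × (Fin N → Fin (T + 1) → Z) => ϱ p.1 p.2.1 (p.2.2 i) :=
    hϱm.comp (f := fun p : Θ × Θ × (Fin N → Fin (T + 1) → Z) => (p.1, p.2.1, p.2.2 i))
      (by fun_prop)
  have hsum : Measurable fun p : Θ × Θ × (Fin N → Fin (T + 1) → Z) =>
      ∑ i, ϱ p.1 p.2.1 (p.2.2 i) := Finset.measurable_sum _ fun i _ => hϱi i
  have hϱNm : Measurable fun p : Θ × Θ × (Fin N → Fin (T + 1) → Z) => ϱN p.1 p.2.1 p.2.2 := by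
    simp_rw [hϱN]
    exact hsum.const_mul _
  have hwm (k : Fin N) : Measurable fun p : Θ × Θ × (Fin N → Fin (T + 1) → Z) =>
      ENNReal.ofReal (w p.1 p.2.1 p.2.2 k) := by
    simp_rw [hw]
    exact (Measurable.ite (measurableSet_lt measurable_const hsum) ((hϱi k).div hsum)
      measurable_const).ennreal_ofReal
  have hNpos : (0 : ℝ) < N := by exact_mod_cast hN
  have hw0 (a b us k) : 0 ≤ w a b us k := by
    rw [hw]
    split_ifs with h
    · exact div_nonneg (hϱ0 _ _ _) h.le
    · positivity
  have hw1 (a b us) : ∑ k, ENNReal.ofReal (w a b us k) = 1 := by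
    rw [← ENNReal.ofReal_sum_of_nonneg fun k _ => hw0 a b us k, ← ENNReal.ofReal_one]
    congr 1
    simp_rw [hw]
    split_ifs with h
    · rw [← Finset.sum_div, div_self h.ne']
    · simp [hNpos.ne']
  have hc : (Fintype.card (Fin N) : ℝ≥0∞) * (N : ℝ≥0∞)⁻¹ = 1 := by
    rw [Fintype.card_fin]
    exact ENNReal.mul_inv_cancel (by exact_mod_cast Nat.one_le_iff_ne_zero.1 hN)
      (ENNReal.natCast_ne_top N)
  have hwd (a b us k) : ENNReal.ofReal (w a b us k) * ENNReal.ofReal (ϱN a b us)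
      = ENNReal.ofReal (ϱ a b (us k)) * (N : ℝ≥0∞)⁻¹ := by
    rw [← ENNReal.ofReal_natCast, ← ENNReal.ofReal_inv_of_pos hNpos,
      ← ENNReal.ofReal_mul (hw0 _ _ _ _), ← ENNReal.ofReal_mul (hϱ0 _ _ _), hw, hϱN]
    congr 1
    split_ifs with h
    · field_simp
    · have h0 : ∑ i, ϱ a b (us i) = 0 :=
        le_antisymm (not_lt.1 h) (Finset.sum_nonneg fun i _ => hϱ0 _ _ _)
      rw [h0, (Finset.sum_eq_zero_iff_of_nonneg fun i _ => hϱ0 _ _ _).1 h0 k (Finset.mem_univ k)]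
      simp
  have hrev : Measurable fun (u : Fin (T + 1) → Z) (i : Fin (T + 1)) => u i.rev := by fun_prop
  have hfirst : Measurable fun u : Fin (T + 1) → Z => u 0 := by fun_prop
  have hlast : Measurable fun u : Fin (T + 1) → Z => u (Fin.last T) := by fun_prop
  have e₁ : Q1N = forwardProposal q Q R (fun u => u (Fin.last T))
      fun a b us k => ENNReal.ofReal (w a b us k) := funext hQ1N
  have e₂ : Q2N = backwardProposal q Q R (fun u i => u i.rev) (fun u => u 0)
      (N : ℝ≥0∞)⁻¹ := funext hQ2N
  have hid := backward_eq_withDensity_forward (ι := Fin N) hrev hfirst hlast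
    (r := fun a b u => ENNReal.ofReal (ϱ a b u)) hϱm.ennreal_ofReal hkey
    (w := fun a b us k => ENNReal.ofReal (w a b us k)) hwm
    (d := fun a b us => ENNReal.ofReal (ϱN a b us)) hϱNm.ennreal_ofReal hwd hw1 hc
  rw [← e₁, ← e₂] at hid
  refine ⟨hid, ?_⟩
  rintro φ hφ ⟨c, hφc⟩
  let K₁ : Kernel (Θ × Z) ((Θ × Z) × (Fin N → Fin (T + 1) → Z) × Fin N) :=
    ⟨Q1N, e₁ ▸ measurable_forwardProposal hlast hwm⟩
  let K₂ : Kernel (Θ × Z) ((Θ × Z) × (Fin N → Fin (T + 1) → Z) × Fin N) :=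
    ⟨Q2N, e₂ ▸ measurable_backwardProposal hrev hfirst⟩
  have : IsMarkovKernel K₁ := ⟨fun x => by
    change IsProbabilityMeasure (Q1N x)
    rw [e₁]
    exact isProbabilityMeasure_forwardProposal hlast hwm hw1 x⟩
  have : IsMarkovKernel K₂ := ⟨fun x => by
    change IsProbabilityMeasure (Q2N x)
    rw [e₂]
    exact isProbabilityMeasure_backwardProposal hrev hfirst hc x⟩
  have : IsProbabilityMeasure (πΘ.bind fun θ => (πZ θ).map fun z => (θ, z)) := by
    constructor
    rw [← lintegral_one, lintegral_bind_map_prodMk measurable_const]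
    simp
  exact detailed_balance_of_withDensity _ K₁ K₂ (a := fun x y v => ϱN x.1 y.1 v.1)
    (hϱNm.comp (f := fun p : (Θ × Z) × (Θ × Z) × (Fin N → Fin (T + 1) → Z) × Fin N =>
      (p.1.1, p.2.1.1, p.2.2.1)) (by fun_prop))
    (fun _ _ _ => hϱN0 _ _ _) hid hφ hφc (fun x => ρ1 x * φ x x) (fun x => ρ2 x * φ x x)
end
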